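/- arXiv:1507.05342 — 7 statements merged into one kernel-verified Lean document; each statement's English description precedes it below -/
import Mathlib

section
/- For every θ ∈ [0, π/2] and every t ∈ ℝ, det(β_θ(t), β_θ′(t), β_θ″(t)) = sin θ·cos²θ, where det denotes the determinant of the 3×3 matrix with the given columns. In particular, for θ ∈ (0, π/2) the kink curve β_θ is a convex spherical curve (it has no inflection points), while for θ = 0 this determinant vanishes identically (β₀ parametrizes a geodesic). -/
open Real Set

/-- Determinant of the 3×3 matrix with columns u, v, w. -/
def det3 (u v w : Fin 3 → ℝ) : ℝ :=
  u 0 * (v 1 * w 2 - v 2 * w 1) - u 1 * (v 0 * w 2 - v 2 * w 0) +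
    u 2 * (v 0 * w 1 - v 1 * w 0)

/-- The kink curve β_θ(t) = (sin²θ + cos²θ·cos t, cos θ·sin t, sin θ·cos θ·(1−cos t)). -/
noncomputable def betaKink (θ t : ℝ) : Fin 3 → ℝ :=
  ![Real.sin θ ^ 2 + Real.cos θ ^ 2 * Real.cos t,
    Real.cos θ * Real.sin t,
    Real.sin θ * Real.cos θ * (1 - Real.cos t)]

theorem deriv_betaKink (θ : ℝ) : deriv (betaKink θ) = fun t =>
    ![-(Real.cos θ ^ 2 * Real.sin t), Real.cos θ * Real.cos t,
      Real.sin θ * Real.cos θ * Real.sin t] := by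
  funext t
  refine HasDerivAt.deriv (hasDerivAt_pi.2 fun i => ?_)
  fin_cases i
  · simpa [betaKink] using ((hasDerivAt_cos t).const_mul (Real.cos θ ^ 2)).const_add (Real.sin θ ^ 2)
  · simpa [betaKink] using (hasDerivAt_sin t).const_mul (Real.cos θ)
  · simpa [betaKink] using ((hasDerivAt_cos t).const_sub 1).const_mul (Real.sin θ * Real.cos θ)

theorem deriv_deriv_betaKink (θ : ℝ) : deriv (deriv (betaKink θ)) = fun t =>
    ![-(Real.cos θ ^ 2 * Real.cos t), -(Real.cos θ * Real.sin t),
      Real.sin θ * Real.cos θ * Real.cos t] := by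
  rw [deriv_betaKink]
  funext t
  refine HasDerivAt.deriv (hasDerivAt_pi.2 fun i => ?_)
  fin_cases i
  · simpa using ((hasDerivAt_sin t).const_mul (Real.cos θ ^ 2)).fun_neg
  · simpa using (hasDerivAt_cos t).const_mul (Real.cos θ)
  · simpa using (hasDerivAt_sin t).const_mul (Real.sin θ * Real.cos θ)

theorem det3_betaKink (θ t : ℝ) :
    det3 (betaKink θ t) (deriv (betaKink θ) t) (deriv (deriv (betaKink θ)) t) =
      Real.sin θ * Real.cos θ ^ 2 := by
  rw [deriv_deriv_betaKink, deriv_betaKink]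
  simp only [det3, betaKink, Matrix.cons_val]
  have ht := Real.sin_sq_add_cos_sq t
  have hθ := Real.sin_sq_add_cos_sq θ
  generalize Real.sin θ = s at *
  generalize Real.cos θ = c at *
  generalize Real.sin t = x at *
  generalize Real.cos t = y at *
  linear_combination (s * c ^ 2 * (s ^ 2 + c ^ 2 * y) + s * c ^ 4 * (1 - y)) * ht + s * c ^ 2 * hθ

/-- det(β_θ, β_θ′, β_θ″) = sin θ cos²θ; convexity for θ ∈ (0,π/2) and
vanishing for θ = 0. -/
theorem kink_convexity (θ : ℝ) (hθ : θ ∈ Set.Icc 0 (π / 2)) (t : ℝ) :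
    det3 (betaKink θ t) (deriv (betaKink θ) t) (deriv (deriv (betaKink θ)) t)
        = Real.sin θ * Real.cos θ ^ 2 ∧
    (θ ∈ Set.Ioo 0 (π / 2) →
      deriv (betaKink θ) t ≠ 0 ∧
      det3 (betaKink θ t) (deriv (betaKink θ) t) (deriv (deriv (betaKink θ)) t) ≠ 0) ∧
    det3 (betaKink 0 t) (deriv (betaKink 0) t) (deriv (deriv (betaKink 0)) t) = 0 := by
  have h_pos : θ ∈ Set.Ioo 0 (π / 2) → 0 < Real.sin θ * Real.cos θ ^ 2 := fun h =>
    mul_pos (sin_pos_of_pos_of_lt_pi h.1 (by linarith [h.2, pi_pos]))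
      (pow_pos (cos_pos_of_mem_Ioo ⟨by linarith [h.1, pi_pos], h.2⟩) 2)
  have h_det : ∀ φ, det3 (betaKink φ t) (deriv (betaKink φ) t) (deriv (deriv (betaKink φ)) t) =
      Real.sin φ * Real.cos φ ^ 2 := fun φ => det3_betaKink φ t
  refine ⟨h_det θ, fun h => ⟨fun h_zero => ?_, ?_⟩, ?_⟩
  · have h_eq := h_det θ
    rw [h_zero] at h_eq
    exact (h_pos h).ne' (by simpa [det3] using h_eq.symm)
  · rw [h_det θ]
    exact (h_pos h).ne'
  · rw [h_det 0]
    simp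
end

section
/- The spherical four-leaf clover κ(t) = (1, cos t·sin 2t, sin t·sin 2t)/√(1 + sin²(2t)) takes values in the unit sphere S², and for every t ∈ ℝ one has κ′(t) ≠ 0 and det(κ(t), κ′(t), κ″(t)) = (1 + sin²(2t))^{−3/2}·(8 − 3·sin²(2t)) > 0. Hence the four-leaf clover lifted to the sphere by the inverse of the central projection is a convex spherical curve. -/
open Real Set

/-- The Euclidean norm of a vector in ℝ³. -/
noncomputable def norm3 (v : Fin 3 → ℝ) : ℝ := Real.sqrt (v 0 ^ 2 + v 1 ^ 2 + v 2 ^ 2)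

/-- The spherical four-leaf clover κ(t) = (1, cos t·sin 2t, sin t·sin 2t)/√(1+sin²2t). -/
noncomputable def sphClover (t : ℝ) : Fin 3 → ℝ :=
  (Real.sqrt (1 + Real.sin (2 * t) ^ 2))⁻¹ •
    ![1, Real.cos t * Real.sin (2 * t), Real.sin t * Real.sin (2 * t)]

/-- Rescaling a curve by a scalar function `g` multiplies `det3 (F, F′, F″)` by `g³`. -/
theorem det3_smul_deriv {g g' : ℝ → ℝ} {F F' : ℝ → Fin 3 → ℝ} {g'' : ℝ} {F'' : Fin 3 → ℝ} {t : ℝ}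
    (hg : ∀ s, HasDerivAt g (g' s) s) (hg' : HasDerivAt g' g'' t)
    (hF : ∀ s, HasDerivAt F (F' s) s) (hF' : HasDerivAt F' F'' t) :
    det3 (g t • F t) (deriv (fun s => g s • F s) t) (deriv (deriv fun s => g s • F s) t) =
      g t ^ 3 * det3 (F t) (F' t) F'' := by
  have h1 : (deriv fun s => g s • F s) = fun s => g s • F' s + g' s • F s :=
    funext fun s => ((hg s).smul (hF s)).deriv
  have h2 : deriv (fun s => g s • F' s + g' s • F s) t =
      (g t • F'' + g' t • F' t) + (g' t • F' t + g'' • F t) :=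
    (((hg t).smul hF').add (hg'.smul (hF t))).deriv
  rw [h1, h2]
  simp only [det3, Pi.add_apply, Pi.smul_apply, smul_eq_mul]
  ring

theorem hasDerivAt_vec3 {a b c : ℝ → ℝ} {a' b' c' t : ℝ} (ha : HasDerivAt a a' t)
    (hb : HasDerivAt b b' t) (hc : HasDerivAt c c' t) :
    HasDerivAt (fun s => ![a s, b s, c s]) ![a', b', c'] t := by
  rw [hasDerivAt_pi]
  intro i
  fin_cases i
  exacts [ha, hb, hc]

theorem hasDerivAt_sin_two_mul (t : ℝ) :
    HasDerivAt (fun s => Real.sin (2 * s)) (2 * Real.cos (2 * t)) t := by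
  simpa [mul_comm] using ((hasDerivAt_id t).const_mul 2).sin

theorem hasDerivAt_cos_two_mul (t : ℝ) :
    HasDerivAt (fun s => Real.cos (2 * s)) (-(2 * Real.sin (2 * t))) t := by
  simpa [mul_comm] using ((hasDerivAt_id t).const_mul 2).cos

theorem contDiff_inv_sqrt_one_add_sin_sq :
    ContDiff ℝ 2 fun t : ℝ => (Real.sqrt (1 + Real.sin (2 * t) ^ 2))⁻¹ := by
  have hpos (t : ℝ) : 0 < 1 + Real.sin (2 * t) ^ 2 := by positivity
  refine ContDiff.inv (ContDiff.sqrt (by fun_prop) fun t => (hpos t).ne') fun t => ?_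
  exact (Real.sqrt_pos.2 (hpos t)).ne'

theorem det3_sphClover (t : ℝ) :
    det3 (sphClover t) (deriv sphClover t) (deriv (deriv sphClover) t) =
      (Real.sqrt (1 + Real.sin (2 * t) ^ 2))⁻¹ ^ 3 * (8 - 3 * Real.sin (2 * t) ^ 2) := by
  have hg := contDiff_inv_sqrt_one_add_sin_sq
  have hg' : Differentiable ℝ (deriv fun t : ℝ => (Real.sqrt (1 + Real.sin (2 * t) ^ 2))⁻¹) :=
    ((contDiff_succ_iff_deriv (n := 1)).1 hg).2.2.differentiable one_ne_zero
  have hs := hasDerivAt_sin_two_mul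
  have hc := hasDerivAt_cos_two_mul
  have hF (s : ℝ) := hasDerivAt_vec3 (hasDerivAt_const s (1 : ℝ))
    ((Real.hasDerivAt_cos s).mul (hs s)) ((Real.hasDerivAt_sin s).mul (hs s))
  have hF' := hasDerivAt_vec3 (hasDerivAt_const t (0 : ℝ))
    (((Real.hasDerivAt_sin t).neg.mul (hs t)).add
      ((Real.hasDerivAt_cos t).mul ((hc t).const_mul 2)))
    (((Real.hasDerivAt_cos t).mul (hs t)).add
      ((Real.hasDerivAt_sin t).mul ((hc t).const_mul 2)))
  refine (det3_smul_deriv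
    (fun s => ((hg.differentiable two_ne_zero) s).hasDerivAt) (hg' t).hasDerivAt hF hF').trans ?_
  congr 1
  have h1 := Real.sin_sq_add_cos_sq t
  have h2 := Real.sin_sq_add_cos_sq (2 * t)
  simp only [det3, Matrix.cons_val, Pi.neg_apply]
  generalize Real.sin (2 * t) = S at *
  generalize Real.cos (2 * t) = C at *
  generalize Real.sin t = s at *
  generalize Real.cos t = c at *
  linear_combination (5 * S ^ 2 + 8 * C ^ 2) * h1 + 8 * h2

theorem norm3_sphClover (t : ℝ) : norm3 (sphClover t) = 1 := by
  have hpos : 0 < 1 + Real.sin (2 * t) ^ 2 := by positivity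
  rw [norm3, Real.sqrt_eq_one]
  simp only [sphClover, Pi.smul_apply, smul_eq_mul, Matrix.cons_val, mul_pow, inv_pow,
    Real.sq_sqrt hpos.le]
  field_simp
  linear_combination Real.sin (2 * t) ^ 2 * Real.sin_sq_add_cos_sq t

/-- the spherical four-leaf clover lies on S² and is a convex spherical
curve, with det(κ, κ′, κ″) = (1+sin²2t)^{−3/2}·(8 − 3sin²2t) > 0. -/
theorem sphClover_convex (t : ℝ) :
    norm3 (sphClover t) = 1 ∧
    deriv sphClover t ≠ 0 ∧
    det3 (sphClover t) (deriv sphClover t) (deriv (deriv sphClover) t)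
        = (1 + Real.sin (2 * t) ^ 2) ^ (-(3 : ℝ) / 2) * (8 - 3 * Real.sin (2 * t) ^ 2) ∧
    0 < det3 (sphClover t) (deriv sphClover t) (deriv (deriv sphClover) t) := by
  have hpos : 0 < 1 + Real.sin (2 * t) ^ 2 := by positivity
  have hdet : 0 < det3 (sphClover t) (deriv sphClover t) (deriv (deriv sphClover) t) := by
    rw [det3_sphClover]
    have := Real.sin_sq_le_one (2 * t)
    exact mul_pos (pow_pos (inv_pos.2 (Real.sqrt_pos.2 hpos)) 3) (by linarith)
  refine ⟨norm3_sphClover t, fun h => ?_, ?_, hdet⟩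
  · rw [h] at hdet
    simp [det3] at hdet
  · rw [det3_sphClover, Real.sqrt_eq_rpow, ← Real.rpow_neg hpos.le, ← Real.rpow_natCast,
      ← Real.rpow_mul hpos.le]
    norm_num
end

section
/- Let γ₀ : [−1,1] → S² be a smooth convex curve (γ₀′(t) ≠ 0 and det(γ₀(t), γ₀′(t), γ₀″(t)) ≠ 0 for all t) with γ₀(0) = (1,0,0) and γ₀′(0)/‖γ₀′(0)‖ = (0,1,0). Then for all sufficiently small ε > 0 there exists a smooth map γ : [0,1] × [−1,1] → S², written γ_s = γ(s,·), such that: γ_0 = γ₀; for every s, sup_t (‖γ_s(t)−γ₀(t)‖ + ‖γ_s′(t)−γ₀′(t)‖) ≤ ε and γ_s(t) = γ₀(t) for |t| ≥ ε; for every s, γ_s(0) = (1,0,0) and γ_s′(0)/‖γ_s′(0)‖ = (0,1,0); for every s ∈ (0,1], γ_s′(t) ≠ 0 for all t and det(γ_s(t), γ_s′(t), γ_s″(t)) ≠ 0 for all t ≠ 0; and γ_1 has infinite order of contact with the horizontal equator at t = 0. -/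
open Real Set

open scoped ContDiff Topology

lemma iteratedDeriv_eq_zero_of_forall_nonpos {f : ℝ → ℝ} (hf : ContDiff ℝ ∞ f)
    (h0 : ∀ u ≤ 0, f u = 0) (n : ℕ) : iteratedDeriv n f 0 = 0 := by
  have hc : Continuous (iteratedDeriv n f) := hf.continuous_iteratedDeriv n (by exact_mod_cast le_top)
  have hneg : ∀ u < 0, iteratedDeriv n f u = 0 := by
    intro u hu
    have : f =ᶠ[𝓝 u] fun _ => (0 : ℝ) := by
      filter_upwards [Iio_mem_nhds hu] with v hv using h0 v (le_of_lt hv)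
    rw [this.iteratedDeriv_eq]
    simp
  have hcl : IsClosed {u | iteratedDeriv n f u = 0} := isClosed_eq hc continuous_const
  have : closure (Iio (0 : ℝ)) ⊆ {u | iteratedDeriv n f u = 0} := closure_minimal hneg hcl
  exact this (by simp)

lemma iteratedDeriv_comp_eq_zero {g f : ℝ → ℝ} (hg : ContDiff ℝ ∞ g) (hf : ContDiff ℝ ∞ f) {x : ℝ}
    (h0 : ∀ n, iteratedDeriv n g (f x) = 0) (n : ℕ) :
    iteratedDeriv n (fun t => g (f t)) x = 0 := by
  obtain ⟨D, hD1, hD⟩ : ∃ D : ℝ, 1 ≤ D ∧ ∀ i ≤ n, ‖iteratedFDeriv ℝ i f x‖ ≤ D := by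
    refine ⟨1 + ∑ i ∈ Finset.range (n + 1), ‖iteratedFDeriv ℝ i f x‖, ?_, fun i hi => ?_⟩
    · have : 0 ≤ ∑ i ∈ Finset.range (n + 1), ‖iteratedFDeriv ℝ i f x‖ := by positivity
      linarith
    · have : ‖iteratedFDeriv ℝ i f x‖ ≤ ∑ i ∈ Finset.range (n + 1), ‖iteratedFDeriv ℝ i f x‖ :=
        Finset.single_le_sum (f := fun i => ‖iteratedFDeriv ℝ i f x‖)
          (fun _ _ => norm_nonneg _) (Finset.mem_range.2 (Nat.lt_succ_of_le hi))
      linarith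
  have key := norm_iteratedFDeriv_comp_le (n := n) (N := ∞) hg hf (by exact_mod_cast le_top) x
    (C := 0) (D := D)
    (fun i _ => by rw [norm_iteratedFDeriv_eq_norm_iteratedDeriv, h0, norm_zero])
    (fun i hi hin => (hD i hin).trans (le_self_pow₀ hD1 (by omega)))
  rw [norm_iteratedFDeriv_eq_norm_iteratedDeriv] at key
  simpa [Function.comp_def] using key

lemma iteratedDeriv_mul_eq_zero {g f : ℝ → ℝ} (hg : ContDiff ℝ ∞ g) (hf : ContDiff ℝ ∞ f) {x : ℝ}
    (h0 : ∀ n, iteratedDeriv n f x = 0) (n : ℕ) :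
    iteratedDeriv n (fun t => g t * f t) x = 0 := by
  rw [iteratedDeriv_fun_mul (hg.contDiffAt.of_le (by exact_mod_cast le_top))
    (hf.contDiffAt.of_le (by exact_mod_cast le_top))]
  simp [h0]

/-- A smooth antitone function equal to `1` on `(-∞, 1/2]` and to `0` on `[1, ∞)`. -/
noncomputable def descent (u : ℝ) : ℝ := Real.smoothTransition (2 - 2 * u)

lemma contDiff_descent : ContDiff ℝ ∞ descent := by
  have : ContDiff ℝ ∞ Real.smoothTransition := Real.smoothTransition.contDiff
  unfold descent
  fun_prop

lemma descent_eq_one {u : ℝ} (hu : u ≤ 1 / 2) : descent u = 1 :=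
  Real.smoothTransition.one_of_one_le (by linarith)

lemma descent_eq_zero {u : ℝ} (hu : 1 ≤ u) : descent u = 0 :=
  Real.smoothTransition.zero_of_nonpos (by linarith)

lemma antitone_descent : Antitone descent := fun a b hab =>
  Real.smoothTransition.monotone (by linarith)

lemma exists_bound_deriv_deriv_descent :
    ∃ B : ℝ, 0 ≤ B ∧ ∀ u > 0, |u * deriv (deriv descent) u| ≤ B := by
  have h2 : Continuous (fun u => u * deriv (deriv descent) u) := by
    have : ContDiff ℝ ∞ (deriv (deriv descent)) :=
      (contDiff_infty_iff_deriv.1 (contDiff_infty_iff_deriv.1 contDiff_descent).2).2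
    exact continuous_id.mul this.continuous
  obtain ⟨B, hB⟩ := (isCompact_Icc (a := (0 : ℝ)) (b := 1)).exists_bound_of_continuousOn
    h2.continuousOn
  refine ⟨B, (norm_nonneg _).trans (hB 0 (by simp)), fun u hu => ?_⟩
  rcases le_or_gt u 1 with h | h
  · exact hB u ⟨hu.le, h⟩
  · have e1 : descent =ᶠ[𝓝 u] fun _ => 0 := by
      filter_upwards [Ioi_mem_nhds h] with v hv using descent_eq_zero (le_of_lt hv)
    have e2 : deriv (deriv descent) u = 0 := by
      rw [e1.deriv.deriv_eq]; simp
    rw [e2]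
    simpa using (norm_nonneg _).trans (hB 0 (by simp))

/-- There is a smooth function, vanishing for `u ≤ 0` and equal to the identity for `u ≥ 1`,
whose derivative times `u ^ (1 / K)` is positive and strictly increasing on `(0, ∞)`. -/
lemma exists_flat_profile (K : ℝ) (hK : 0 < K) : ∃ Φ : ℝ → ℝ, ContDiff ℝ ∞ Φ ∧
    (∀ u ≤ 0, Φ u = 0) ∧ (∀ u ≥ 1, Φ u = u) ∧
    (∀ u > 0, 0 < deriv Φ u ∧ 0 < deriv Φ u + K * (u * deriv (deriv Φ) u)) := by
  obtain ⟨B, hB0, hB⟩ := exists_bound_deriv_deriv_descent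
  obtain ⟨κ, hκ, hκB⟩ : ∃ κ > 0, K * κ * B < 1 := by
    refine ⟨1 / (K * (B + 1)), by positivity, ?_⟩
    have : K * (1 / (K * (B + 1))) * B = B / (B + 1) := by field_simp
    rw [this, div_lt_one (by positivity)]
    linarith
  set Φ : ℝ → ℝ := fun u => if u ≤ 0 then 0 else u * exp (-(κ * descent u / u)) with hΦ
  have hpos : ∀ u > 0, Φ u = u * exp (-(κ * descent u / u)) := fun u hu => by
    simp [hΦ, not_le.2 hu]
  have hev : ∀ u > 0, Φ =ᶠ[𝓝 u] fun u => u * exp (-(κ * descent u / u)) := fun u hu => by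
    filter_upwards [Ioi_mem_nhds hu] with v hv using hpos v hv
  have hd0 : Differentiable ℝ descent := contDiff_descent.differentiable (by simp)
  have hd1 : Differentiable ℝ (deriv descent) :=
    ((contDiff_infty_iff_deriv.1 contDiff_descent).2).differentiable (by simp)
  have hD1 : ∀ u > 0, deriv Φ u =
      exp (-(κ * descent u / u)) * (1 + κ * (descent u - u * deriv descent u) / u) := by
    intro u hu
    rw [(hev u hu).deriv_eq]
    have hw := (((hd0 u).hasDerivAt.const_mul κ).div (hasDerivAt_id u) hu.ne').neg.exp
    have := ((hasDerivAt_id u).mul hw).deriv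
    simp only [id, Pi.mul_def, Pi.div_def, Pi.neg_def] at this
    rw [this]
    field_simp
    ring
  have hD2 : ∀ u > 0, u * deriv (deriv Φ) u = exp (-(κ * descent u / u)) *
      ((κ * (descent u - u * deriv descent u) / u) ^ 2 - κ * (u * deriv (deriv descent) u)) := by
    intro u hu
    have : deriv Φ =ᶠ[𝓝 u] fun u => exp (-(κ * descent u / u)) *
        (1 + κ * (descent u - u * deriv descent u) / u) := by
      filter_upwards [Ioi_mem_nhds hu] with v hv using hD1 v hv
    rw [this.deriv_eq]
    have hw := (((hd0 u).hasDerivAt.const_mul κ).div (hasDerivAt_id u) hu.ne').neg.exp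
    have hp := (((((hd0 u).hasDerivAt.sub ((hasDerivAt_id u).mul (hd1 u).hasDerivAt)).const_mul
      κ).div (hasDerivAt_id u) hu.ne').const_add 1)
    have := (hw.mul hp).deriv
    simp only [id, Pi.mul_def, Pi.div_def, Pi.neg_def, Pi.sub_def] at this
    rw [this]
    field_simp
    ring
  refine ⟨Φ, ?_, fun u hu => by simp [hΦ, hu], fun u hu => ?_, fun u hu => ?_⟩
  · rw [contDiff_iff_contDiffAt]
    intro u
    rcases lt_or_ge u (1 / 2) with h | h
    · have : Φ =ᶠ[𝓝 u] fun u => u * expNegInvGlue (u / κ) := by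
        filter_upwards [Iio_mem_nhds h] with v hv
        rcases le_or_gt v 0 with h' | h'
        · simp [hΦ, h']
          right
          exact div_nonpos_of_nonpos_of_nonneg h' hκ.le
        · have : ¬ (v / κ ≤ 0) := not_le.2 (by positivity)
          rw [hpos v h', descent_eq_one (le_of_lt hv), expNegInvGlue, if_neg this]
          congr 2
          field_simp
      refine ContDiffAt.congr_of_eventuallyEq ?_ this
      have : ContDiff ℝ ∞ expNegInvGlue := expNegInvGlue.contDiff
      fun_prop
    · have hu : 0 < u := by linarith
      refine ContDiffAt.congr_of_eventuallyEq ?_ (hev u hu)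
      have := contDiff_descent.contDiffAt (x := u)
      fun_prop (disch := exact hu.ne')
  · rw [hpos u (by linarith), descent_eq_zero hu]; simp
  · have hp : 0 ≤ κ * (descent u - u * deriv descent u) / u := by
      have h1 : deriv descent u ≤ 0 := antitone_descent.deriv_nonpos
      have h2 : 0 ≤ descent u := Real.smoothTransition.nonneg _
      have : 0 ≤ descent u - u * deriv descent u := by nlinarith
      positivity
    have hb := (abs_le.1 (hB u hu)).2
    have hE := exp_pos (-(κ * descent u / u))
    rw [hD2 u hu, hD1 u hu]
    set p := κ * (descent u - u * deriv descent u) / u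
    refine ⟨by positivity, ?_⟩
    have h3 : K * κ * (u * deriv (deriv descent) u) ≤ K * κ * B := by gcongr
    have h4 : 0 ≤ K * p ^ 2 := by positivity
    have : 0 < exp (-(κ * descent u / u)) *
      (1 + p + K * p ^ 2 - K * κ * (u * deriv (deriv descent) u)) := by
      apply mul_pos hE; linarith
    linarith

lemma abs_le_mul_abs_of_abs_deriv_le {f : ℝ → ℝ} {C r : ℝ} (hf : Differentiable ℝ f)
    (h0 : f 0 = 0) (hC : ∀ t, |t| < r → |deriv f t| ≤ C) {t : ℝ} (ht : |t| < r) :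
    |f t| ≤ C * |t| := by
  have hr : 0 < r := (abs_nonneg t).trans_lt ht
  have := (convex_ball (0 : ℝ) r).norm_image_sub_le_of_norm_deriv_le (f := f) (C := C)
    (fun x _ => hf x) (fun x hx => hC x (by simpa using hx)) (x := 0) (y := t)
    (by simpa using hr) (by simpa using ht)
  simpa [h0] using this

/-- Rescaled version of `exists_flat_profile`, with bounds independent of the scale. -/
lemma exists_scaled_flat_profile (K : ℝ) (hK : 0 < K) : ∃ C : ℝ, 0 ≤ C ∧ ∀ δ > 0, ∃ Ψ : ℝ → ℝ,
    ContDiff ℝ ∞ Ψ ∧ (∀ u ≤ 0, Ψ u = 0) ∧ (∀ u ≥ δ, Ψ u = u) ∧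
    (∀ u, |deriv Ψ u| ≤ C) ∧ (∀ u, |Ψ u| ≤ C * |u|) ∧
    (∀ u > 0, 0 < deriv Ψ u ∧ 0 < deriv Ψ u + K * (u * deriv (deriv Ψ) u)) := by
  obtain ⟨Φ, hΦ, hΦ0, hΦ1, hΦd⟩ := exists_flat_profile K hK
  have hΦ' : ContDiff ℝ ∞ (deriv Φ) := (contDiff_infty_iff_deriv.1 hΦ).2
  have hd : Differentiable ℝ Φ := hΦ.differentiable (by simp)
  have hd' : Differentiable ℝ (deriv Φ) := hΦ'.differentiable (by simp)
  obtain ⟨C, hC1, hC⟩ : ∃ C : ℝ, 1 ≤ C ∧ ∀ u, |deriv Φ u| ≤ C := by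
    obtain ⟨C, hC⟩ := (isCompact_Icc (a := (0 : ℝ)) (b := 1)).exists_bound_of_continuousOn
      hΦ'.continuous.continuousOn
    refine ⟨max C 1, le_max_right _ _, fun u => ?_⟩
    rcases lt_or_ge u 0 with h | h
    · have : Φ =ᶠ[𝓝 u] fun _ => 0 := by
        filter_upwards [Iio_mem_nhds h] with v hv using hΦ0 v (le_of_lt hv)
      rw [this.deriv_eq]
      simp
    rcases le_or_gt u 1 with h' | h'
    · exact (hC u ⟨h, h'⟩).trans (le_max_left _ _)
    · have : Φ =ᶠ[𝓝 u] fun v => v := by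
        filter_upwards [Ioi_mem_nhds h'] with v hv using hΦ1 v (le_of_lt hv)
      rw [this.deriv_eq]
      simp
  refine ⟨C, by linarith, fun δ hδ => ?_⟩
  have h1 : ∀ u, HasDerivAt (fun u => δ * Φ (u / δ)) (deriv Φ (u / δ)) u := fun u => by
    have := (((hd (u / δ)).hasDerivAt.comp u ((hasDerivAt_id u).div_const δ))).const_mul δ
    rwa [show δ * (deriv Φ (u / δ) * (1 / δ)) = deriv Φ (u / δ) by field_simp] at this
  have h1' : deriv (fun u => δ * Φ (u / δ)) = fun u => deriv Φ (u / δ) :=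
    funext fun u => (h1 u).deriv
  have h2 : ∀ u, deriv (fun u => deriv Φ (u / δ)) u = deriv (deriv Φ) (u / δ) / δ := fun u => by
    have := (((hd' (u / δ)).hasDerivAt.comp u ((hasDerivAt_id u).div_const δ))).deriv
    simp only [Function.comp_def, id] at this
    rw [this]
    ring
  have h0 : δ * Φ (0 / δ) = 0 := by simp [hΦ0 0 le_rfl]
  refine ⟨fun u => δ * Φ (u / δ), by fun_prop, fun u hu => ?_, fun u hu => ?_, fun u => ?_,
    fun u => ?_, fun u hu => ?_⟩
  · simp [hΦ0 (u / δ) (div_nonpos_of_nonpos_of_nonneg hu hδ.le)]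
  · simp only [hΦ1 (u / δ) ((one_le_div hδ).2 hu)]
    field_simp
  · rw [h1']; exact hC _
  · exact abs_le_mul_abs_of_abs_deriv_le (f := fun u => δ * Φ (u / δ))
      (fun u => (h1 u).differentiableAt) h0
      (fun t _ => by rw [h1']; exact hC _) (lt_add_one |u|)
  · rw [h1', h2]
    have := hΦd (u / δ) (by positivity)
    refine ⟨this.1, ?_⟩
    convert this.2 using 3
    ring

lemma mul_sq_le_of_le_deriv_deriv {f : ℝ → ℝ} {m r : ℝ} (hf : ContDiff ℝ ∞ f)
    (h0 : f 0 = 0) (h1 : deriv f 0 = 0) (hm : ∀ t, |t| < r → m ≤ deriv (deriv f) t) {t : ℝ}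
    (ht : |t| < r) : m / 2 * t ^ 2 ≤ f t := by
  have hf' : ContDiff ℝ ∞ (deriv f) := (contDiff_infty_iff_deriv.1 hf).2
  have hd : Differentiable ℝ f := hf.differentiable (by simp)
  have hd' : Differentiable ℝ (deriv f) := hf'.differentiable (by simp)
  have hr : 0 < r := (abs_nonneg t).trans_lt ht
  have hdm : Differentiable ℝ fun t => deriv f t - m * t := by fun_prop
  have hdq : Differentiable ℝ fun t => f t - m / 2 * t ^ 2 := by fun_prop
  have hmono : MonotoneOn (fun t => deriv f t - m * t) (Ioo (-r) r) := by
    refine monotoneOn_of_deriv_nonneg (convex_Ioo _ _) hdm.continuous.continuousOn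
      hdm.differentiableOn fun x hx => ?_
    rw [interior_Ioo] at hx
    have := (((hd' x).hasDerivAt).sub ((hasDerivAt_id x).const_mul m)).deriv
    simp only [id, Pi.sub_def] at this
    rw [this]
    linarith [hm x (abs_lt.2 hx)]
  have hder : ∀ x, deriv (fun t => f t - m / 2 * t ^ 2) x = deriv f x - m * x := fun x => by
    have := (((hd x).hasDerivAt).sub ((hasDerivAt_pow 2 x).const_mul (m / 2))).deriv
    simp only [Pi.sub_def] at this
    rw [this]
    push_cast
    ring
  have key : 0 ≤ f t - m / 2 * t ^ 2 := by
    rcases le_total 0 t with h | h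
    · have : MonotoneOn (fun t => f t - m / 2 * t ^ 2) (Ico 0 r) := by
        refine monotoneOn_of_deriv_nonneg (convex_Ico _ _) hdq.continuous.continuousOn
          hdq.differentiableOn fun x hx => ?_
        rw [interior_Ico] at hx
        rw [hder]
        simpa [h1] using hmono (a := 0) (b := x) ⟨by linarith, hr⟩ ⟨by linarith [hx.1], hx.2⟩ hx.1.le
      simpa [h0] using this (a := 0) (b := t) ⟨le_rfl, hr⟩ ⟨h, (abs_lt.1 ht).2⟩ h
    · have : AntitoneOn (fun t => f t - m / 2 * t ^ 2) (Ioc (-r) 0) := by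
        refine antitoneOn_of_deriv_nonpos (convex_Ioc _ _) hdq.continuous.continuousOn
          hdq.differentiableOn fun x hx => ?_
        rw [interior_Ioc] at hx
        rw [hder]
        simpa [h1] using hmono (a := x) (b := 0) ⟨hx.1, by linarith [hx.2]⟩ ⟨by linarith, hr⟩ hx.2.le
      simpa [h0] using this (a := t) (b := 0) ⟨(abs_lt.1 ht).1, h⟩ ⟨by linarith, le_rfl⟩ h
  linarith

/-- The determinant `Y' Z'' - Z' Y''` detecting inflection points of the plane curve `(Y, Z)`. -/
noncomputable def planarWronskian (Y Z : ℝ → ℝ) (t : ℝ) : ℝ :=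
  deriv Y t * deriv (deriv Z) t - deriv Z t * deriv (deriv Y) t

lemma planarWronskian_congr {Y Z Z' : ℝ → ℝ} {t : ℝ} (h : Z =ᶠ[𝓝 t] Z') :
    planarWronskian Y Z t = planarWronskian Y Z' t := by
  rw [planarWronskian, planarWronskian, h.deriv.deriv_eq, h.deriv_eq]

lemma planarWronskian_comp {Y Z θ : ℝ → ℝ} (hZ : ContDiff ℝ ∞ Z) (hθ : ContDiff ℝ ∞ θ) (t : ℝ) :
    planarWronskian Y (fun τ => θ (Z τ)) t =
      deriv θ (Z t) * planarWronskian Y Z t +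
        deriv (deriv θ) (Z t) * (deriv Y t * deriv Z t ^ 2) := by
  have hd : Differentiable ℝ Z := hZ.differentiable (by simp)
  have hd' : Differentiable ℝ (deriv Z) :=
    ((contDiff_infty_iff_deriv.1 hZ).2).differentiable (by simp)
  have hθd : Differentiable ℝ θ := hθ.differentiable (by simp)
  have hθd' : Differentiable ℝ (deriv θ) :=
    ((contDiff_infty_iff_deriv.1 hθ).2).differentiable (by simp)
  have h1 : deriv (fun τ => θ (Z τ)) = fun τ => deriv θ (Z τ) * deriv Z τ :=
    funext fun τ => ((hθd (Z τ)).hasDerivAt.comp τ (hd τ).hasDerivAt).deriv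
  have h2 : deriv (fun τ => deriv θ (Z τ) * deriv Z τ) t = _ :=
    (((hθd' (Z t)).hasDerivAt.comp t (hd t).hasDerivAt).mul (hd' t).hasDerivAt).deriv
  rw [planarWronskian, h1, h2, planarWronskian]
  simp only [Function.comp]
  ring

/-- Local estimates for a plane curve touching the horizontal axis from above at `t = 0`. -/
lemma exists_local_estimates {Y Z : ℝ → ℝ} (hY : ContDiff ℝ ∞ Y) (hZ : ContDiff ℝ ∞ Z)
    (hZ0 : Z 0 = 0) (hZ1 : deriv Z 0 = 0) (hY1 : 0 < deriv Y 0) (hZ2 : 0 < deriv (deriv Z) 0) :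
    ∃ r > 0, ∃ m > 0, ∀ t, |t| < r → m * t ^ 2 ≤ Z t ∧ 0 < planarWronskian Y Z t ∧
      0 < deriv Y t ∧ deriv Y t * deriv Z t ^ 2 ≤ 64 * (Z t * planarWronskian Y Z t) := by
  have hY' : ContDiff ℝ ∞ (deriv Y) := (contDiff_infty_iff_deriv.1 hY).2
  have hY'' : ContDiff ℝ ∞ (deriv (deriv Y)) := (contDiff_infty_iff_deriv.1 hY').2
  have hZ' : ContDiff ℝ ∞ (deriv Z) := (contDiff_infty_iff_deriv.1 hZ).2
  have hZ'' : ContDiff ℝ ∞ (deriv (deriv Z)) := (contDiff_infty_iff_deriv.1 hZ').2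
  have hW : Continuous (planarWronskian Y Z) :=
    (hY'.continuous.mul hZ''.continuous).sub (hZ'.continuous.mul hY''.continuous)
  set c := deriv Y 0 with hc
  set a := deriv (deriv Z) 0 with ha
  have hW0 : planarWronskian Y Z 0 = c * a := by simp [planarWronskian, hZ1, hc, ha]
  have hca : 0 < c * a := mul_pos hY1 hZ2
  have ev : ∀ᶠ t in 𝓝 (0 : ℝ), a / 2 < deriv (deriv Z) t ∧ deriv (deriv Z) t < 2 * a ∧
      c / 2 < deriv Y t ∧ deriv Y t < 2 * c ∧ c * a / 2 < planarWronskian Y Z t := by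
    refine (hZ''.continuous.continuousAt.eventually_const_lt (by linarith)).and
      ((hZ''.continuous.continuousAt.eventually_lt_const (by linarith)).and
      ((hY'.continuous.continuousAt.eventually_const_lt (by linarith)).and
      ((hY'.continuous.continuousAt.eventually_lt_const (by linarith)).and
      (hW.continuousAt.eventually_const_lt (by linarith)))))
  obtain ⟨r, hr, h⟩ := Metric.eventually_nhds_iff.1 ev
  simp only [dist_zero_right, Real.norm_eq_abs] at h
  refine ⟨r, hr, a / 4, by linarith, fun t ht => ?_⟩
  have hq := mul_sq_le_of_le_deriv_deriv hZ hZ0 hZ1 (fun t ht => (h ht).1.le) ht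
  have hl : |deriv Z t| ≤ 2 * a * |t| :=
    abs_le_mul_abs_of_abs_deriv_le (hZ'.differentiable (by simp)) hZ1
      (fun t ht => abs_le.2 ⟨by linarith [(h ht).1], (h ht).2.1.le⟩) ht
  obtain ⟨-, -, h3, h4, h5⟩ := h ht
  have hW0 : 0 < planarWronskian Y Z t := by linarith
  refine ⟨by linarith, hW0, by linarith, ?_⟩
  have hsq : deriv Z t ^ 2 ≤ (2 * a * |t|) ^ 2 := by
    rw [← sq_abs]; gcongr
  calc deriv Y t * deriv Z t ^ 2 ≤ (2 * c) * (2 * a * |t|) ^ 2 := by gcongr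
    _ = 64 * ((a / 2 / 2 * t ^ 2) * (c * a / 2)) := by rw [mul_pow, sq_abs]; ring
    _ ≤ 64 * (Z t * planarWronskian Y Z t) := by gcongr; nlinarith [sq_nonneg t]

lemma exists_flattening_of_pos {Y Z : ℝ → ℝ} (hY : ContDiff ℝ ∞ Y) (hZ : ContDiff ℝ ∞ Z)
    (hZ0 : Z 0 = 0) (hZ1 : deriv Z 0 = 0) (hY1 : 0 < deriv Y 0) (hZ2 : 0 < deriv (deriv Z) 0)
    {ε : ℝ} (hε : 0 < ε) :
    ∃ η, 0 < η ∧ η ≤ ε ∧ ∃ q : ℝ → ℝ, ContDiff ℝ ∞ q ∧ (∀ t, η / 2 ≤ |t| → q t = 0) ∧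
      (∀ t, |t| < η → |q t| ≤ ε ∧ |deriv q t| ≤ ε) ∧ q 0 = 0 ∧ deriv q 0 = 0 ∧
      (∀ n, iteratedDeriv n (fun t => Z t + q t) 0 = 0) ∧
      ∀ s ∈ Ioc (0 : ℝ) 1, ∀ t, |t| < η → t ≠ 0 →
        planarWronskian Y (fun τ => Z τ + s * q τ) t ≠ 0 := by
  obtain ⟨r, hr, m, hm, hest⟩ := exists_local_estimates hY hZ hZ0 hZ1 hY1 hZ2
  obtain ⟨C, hC0, hprof⟩ := exists_scaled_flat_profile 64 (by norm_num)
  have hZ' : ContDiff ℝ ∞ (deriv Z) := (contDiff_infty_iff_deriv.1 hZ).2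
  have ev : ∀ᶠ t in 𝓝 (0 : ℝ), (C + 1) * |Z t| < ε ∧ (C + 1) * |deriv Z t| < ε := by
    have h1 : Continuous fun t => (C + 1) * |Z t| := continuous_const.mul hZ.continuous.abs
    have h2 : Continuous fun t => (C + 1) * |deriv Z t| := continuous_const.mul hZ'.continuous.abs
    exact (h1.continuousAt.eventually_lt_const (by simpa [hZ0])).and
      (h2.continuousAt.eventually_lt_const (by simpa [hZ1]))
  obtain ⟨ρ, hρ, hsmall⟩ := Metric.eventually_nhds_iff.1 ev
  simp only [dist_zero_right, Real.norm_eq_abs] at hsmall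
  obtain ⟨η, hη, hηε, hηρ, hηr⟩ : ∃ η : ℝ, 0 < η ∧ η ≤ ε ∧ η ≤ ρ ∧ 2 * η ≤ r :=
    ⟨min ε (min ρ (r / 2)), by positivity, min_le_left _ _,
      (min_le_right _ _).trans (min_le_left _ _), by
      linarith [(min_le_right ε (min ρ (r / 2))).trans (min_le_right _ _)]⟩
  obtain ⟨Ψ, hΨ, hΨ0, hΨδ, hΨd, hΨb, hΨpos⟩ := hprof (m * (η / 2) ^ 2) (by positivity)
  have hdZ : Differentiable ℝ Z := hZ.differentiable (by simp)
  have hdΨ : Differentiable ℝ Ψ := hΨ.differentiable (by simp)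
  have hdΨ' : Differentiable ℝ (deriv Ψ) :=
    ((contDiff_infty_iff_deriv.1 hΨ).2).differentiable (by simp)
  let χ : ContDiffBump (0 : ℝ) := ⟨η, 2 * η, hη, by linarith⟩
  set q : ℝ → ℝ := fun t => χ t * (Ψ (Z t) - Z t) with hqdef
  have hχ : ContDiff ℝ ∞ χ := χ.contDiff
  have hq : ContDiff ℝ ∞ q := by fun_prop
  have hqeq : ∀ t, |t| < η → q t = Ψ (Z t) - Z t := fun t ht => by
    have : χ t = 1 := χ.one_of_mem_closedBall (by simpa [χ] using ht.le)
    simp [hqdef, this]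
  have hqev : ∀ t, |t| < η → q =ᶠ[𝓝 t] fun t => Ψ (Z t) - Z t := fun t ht => by
    have : {x : ℝ | |x| < η} ∈ 𝓝 t := (isOpen_lt continuous_abs continuous_const).mem_nhds ht
    filter_upwards [this] with x hx using hqeq x hx
  have hqd : ∀ t, |t| < η → deriv q t = deriv Ψ (Z t) * deriv Z t - deriv Z t := fun t ht => by
    rw [(hqev t ht).deriv_eq]
    exact (((hdΨ (Z t)).hasDerivAt.comp t (hdZ t).hasDerivAt).sub (hdZ t).hasDerivAt).deriv
  refine ⟨η, hη, hηε, q, hq, fun t ht => ?_, fun t ht => ⟨?_, ?_⟩, ?_, ?_, fun n => ?_,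
    fun s hs t ht ht0 => ?_⟩
  · rcases lt_or_ge |t| (2 * η) with h | h
    · have h1 : m * (η / 2) ^ 2 ≤ Z t := by
        refine le_trans ?_ (hest t (h.trans_le hηr)).1
        rw [← sq_abs t]
        gcongr
      simp [hqdef, hΨδ _ h1]
    · have : χ t = 0 := χ.zero_of_le_dist (by simpa [χ] using h)
      simp [hqdef, this]
  · rw [hqeq t ht]
    have := (hsmall (ht.trans_le hηρ)).1
    linarith [abs_sub (Ψ (Z t)) (Z t), hΨb (Z t)]
  · rw [hqd t ht]
    have := (hsmall (ht.trans_le hηρ)).2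
    have h2 := abs_sub (deriv Ψ (Z t) * deriv Z t) (deriv Z t)
    have h3 : |deriv Ψ (Z t) * deriv Z t| ≤ C * |deriv Z t| := by
      rw [abs_mul]; gcongr; exact hΨd _
    linarith
  · rw [hqeq 0 (by simpa using hη), hZ0, hΨ0 0 le_rfl, sub_zero]
  · rw [hqd 0 (by simpa using hη), hZ1]; simp
  · have : (fun t => Z t + q t) =ᶠ[𝓝 0] fun t => Ψ (Z t) := by
      filter_upwards [hqev 0 (by simpa using hη)] with t ht
      rw [ht]; ring
    rw [this.iteratedDeriv_eq]
    refine iteratedDeriv_comp_eq_zero hΨ hZ (fun n => ?_) n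
    rw [hZ0]
    exact iteratedDeriv_eq_zero_of_forall_nonpos hΨ hΨ0 n
  · have hcongr : (fun τ => Z τ + s * q τ) =ᶠ[𝓝 t]
        fun τ => (fun u => (1 - s) * u + s * Ψ u) (Z τ) := by
      filter_upwards [hqev t ht] with τ hτ
      rw [hτ]; ring
    rw [planarWronskian_congr hcongr,
      planarWronskian_comp (θ := fun u => (1 - s) * u + s * Ψ u) hZ (by fun_prop)]
    have hθ1 : deriv (fun u => (1 - s) * u + s * Ψ u) = fun u => (1 - s) + s * deriv Ψ u :=
      funext fun u => by
        have := (((hasDerivAt_id u).const_mul (1 - s)).add ((hdΨ u).hasDerivAt.const_mul s)).deriv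
        simpa [Pi.add_def] using this
    have hθ2 : deriv (fun u => (1 - s) + s * deriv Ψ u) (Z t) = s * deriv (deriv Ψ) (Z t) :=
      (((hdΨ' (Z t)).hasDerivAt.const_mul s).const_add (1 - s)).deriv
    rw [hθ1, hθ2]
    obtain ⟨e1, e2, e3, e4⟩ := hest t (by linarith)
    have hZpos : 0 < Z t := by
      have : 0 < t ^ 2 := by positivity
      nlinarith
    obtain ⟨p1, p2⟩ := hΨpos _ hZpos
    set w := planarWronskian Y Z t
    set A := deriv Ψ (Z t)
    set D := deriv (deriv Ψ) (Z t)
    set v := deriv Y t * deriv Z t ^ 2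
    have hv : 0 ≤ v := by positivity
    have hmain : 0 < A * w + D * v := by
      rcases le_or_gt 0 D with hD | hD
      · have := mul_pos p1 e2
        have := mul_nonneg hD hv
        linarith
      · have h1 : D * (64 * (Z t * w)) ≤ D * v := mul_le_mul_of_nonpos_left e4 hD.le
        have h2 : 0 < (A + 64 * (Z t * D)) * w := mul_pos p2 e2
        linarith
    have h1 : 0 ≤ (1 - s) * w := mul_nonneg (by linarith [hs.2]) e2.le
    have h2 : 0 < s * (A * w + D * v) := mul_pos hs.1 hmain
    apply ne_of_gt
    linarith

/-- A plane curve with a nondegenerate horizontal tangency at `t = 0` can be deformed, `C¹`-slightly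
and near `t = 0` only, to one with infinite order of contact with the axis, so that no inflection
points appear at `t ≠ 0`. -/
lemma exists_flattening {Y Z : ℝ → ℝ} (hY : ContDiff ℝ ∞ Y) (hZ : ContDiff ℝ ∞ Z)
    (hZ0 : Z 0 = 0) (hZ1 : deriv Z 0 = 0) (hY1 : 0 < deriv Y 0) (hZ2 : deriv (deriv Z) 0 ≠ 0)
    {ε : ℝ} (hε : 0 < ε) :
    ∃ η, 0 < η ∧ η ≤ ε ∧ ∃ q : ℝ → ℝ, ContDiff ℝ ∞ q ∧ (∀ t, η / 2 ≤ |t| → q t = 0) ∧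
      (∀ t, |t| < η → |q t| ≤ ε ∧ |deriv q t| ≤ ε) ∧ q 0 = 0 ∧ deriv q 0 = 0 ∧
      (∀ n, iteratedDeriv n (fun t => Z t + q t) 0 = 0) ∧
      ∀ s ∈ Ioc (0 : ℝ) 1, ∀ t, |t| < η → t ≠ 0 →
        planarWronskian Y (fun τ => Z τ + s * q τ) t ≠ 0 := by
  rcases hZ2.lt_or_gt with h | h
  · have hd : deriv (fun t => -Z t) = fun t => -deriv Z t := deriv.fun_neg'
    obtain ⟨η, hη, hηε, q, h1, h2, h3, h4, h5, h6, h7⟩ :=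
      exists_flattening_of_pos (Z := fun t => -Z t) hY hZ.neg (by simp [hZ0]) (by simp [hd, hZ1])
        hY1 (by simpa [hd] using h) hε
    refine ⟨η, hη, hηε, fun t => -q t, h1.neg, fun t ht => by simp [h2 t ht], fun t ht => ?_,
      by simp [h4], by simp [h5], fun n => ?_, fun s hs t ht ht0 => ?_⟩
    · simpa using h3 t ht
    · have e : (fun t => Z t + -q t) = fun t => -(-Z t + q t) := by ext t; ring
      rw [e, iteratedDeriv_fun_neg, h6, neg_zero]
    · have e : (fun τ => Z τ + s * -q τ) = fun τ => -(-Z τ + s * q τ) := by ext τ; ring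
      have := h7 s hs t ht ht0
      rw [e]
      contrapose! this
      simp only [planarWronskian, deriv.fun_neg'] at this ⊢
      linarith
  · exact exists_flattening_of_pos hY hZ hZ0 hZ1 hY1 h hε

/-- Central projection of the affine chart `x = 1` to the unit sphere. -/
noncomputable def toSphere (p : ℝ × ℝ) : Fin 3 → ℝ :=
  (√(1 + p.1 ^ 2 + p.2 ^ 2))⁻¹ • ![1, p.1, p.2]

lemma contDiff_inv_sqrt_one_add {E : Type*} [NormedAddCommGroup E] [NormedSpace ℝ E]
    {f g : E → ℝ} (hf : ContDiff ℝ ∞ f) (hg : ContDiff ℝ ∞ g) :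
    ContDiff ℝ ∞ fun x => (√(1 + f x ^ 2 + g x ^ 2))⁻¹ := by
  have h : ∀ x, 0 < 1 + f x ^ 2 + g x ^ 2 := fun x => by positivity
  exact ContDiff.inv (ContDiff.sqrt (by fun_prop) fun x => (h x).ne')
    fun x => (Real.sqrt_pos.2 (h x)).ne'

lemma contDiff_toSphere : ContDiff ℝ ∞ toSphere := by
  refine (contDiff_inv_sqrt_one_add contDiff_fst contDiff_snd).smul (contDiff_pi.2 fun i => ?_)
  fin_cases i
  · exact contDiff_const
  · exact contDiff_fst
  · exact contDiff_snd

lemma norm3_toSphere (p : ℝ × ℝ) : norm3 (toSphere p) = 1 := by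
  have h : 0 < 1 + p.1 ^ 2 + p.2 ^ 2 := by positivity
  have hs := Real.sq_sqrt h.le
  have hs0 := Real.sqrt_pos.2 h
  rw [norm3, Real.sqrt_eq_one]
  simp only [toSphere, Pi.smul_apply, smul_eq_mul, Matrix.cons_val]
  field_simp
  linarith

lemma norm3_le_two_mul_norm (v : Fin 3 → ℝ) : norm3 v ≤ 2 * ‖v‖ := by
  have h : ∀ i, v i ^ 2 ≤ ‖v‖ ^ 2 := fun i => by
    rw [← sq_abs]
    gcongr
    exact norm_le_pi_norm v i
  rw [norm3]
  refine Real.sqrt_le_iff.2 ⟨by positivity, ?_⟩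
  nlinarith [h 0, h 1, h 2, sq_nonneg ‖v‖]

lemma norm3_zero : norm3 0 = 0 := by simp [norm3]

lemma toSphere_div_eq_self {v : Fin 3 → ℝ} (hv : norm3 v = 1) (h0 : 0 < v 0) :
    toSphere (v 1 / v 0, v 2 / v 0) = v := by
  have h1 : v 0 ^ 2 + v 1 ^ 2 + v 2 ^ 2 = 1 := by rwa [norm3, Real.sqrt_eq_one] at hv
  have h2 : √(1 + (v 1 / v 0) ^ 2 + (v 2 / v 0) ^ 2) = (v 0)⁻¹ := by
    rw [Real.sqrt_eq_iff_mul_self_eq (by positivity) (by positivity)]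
    field_simp
    linarith
  ext i
  fin_cases i <;> simp [toSphere, h2] <;> field_simp

lemma det3_congr {c d : ℝ → Fin 3 → ℝ} {t : ℝ} (h : c =ᶠ[𝓝 t] d) :
    det3 (c t) (deriv c t) (deriv (deriv c) t) = det3 (d t) (deriv d t) (deriv (deriv d) t) := by
  rw [h.deriv.deriv_eq, h.deriv_eq, h.eq_of_nhds]

lemma det3_smul_affine {n Y Z : ℝ → ℝ} (hn : ContDiff ℝ ∞ n) (hY : ContDiff ℝ ∞ Y)
    (hZ : ContDiff ℝ ∞ Z) {c : ℝ → Fin 3 → ℝ} (hc : c = fun t => n t • ![1, Y t, Z t]) (t : ℝ) :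
    det3 (c t) (deriv c t) (deriv (deriv c) t) = n t ^ 3 * planarWronskian Y Z t := by
  have d1 : ∀ {f : ℝ → ℝ}, ContDiff ℝ ∞ f → ∀ t, HasDerivAt f (deriv f t) t := fun hf t =>
    (hf.differentiable (by simp) t).hasDerivAt
  have d2 : ∀ {f : ℝ → ℝ}, ContDiff ℝ ∞ f → ∀ t, HasDerivAt (deriv f) (deriv (deriv f) t) t :=
    fun hf t => (((contDiff_infty_iff_deriv.1 hf).2).differentiable (by simp) t).hasDerivAt
  have hc1 : deriv c = fun t => ![deriv n t, deriv n t * Y t + n t * deriv Y t,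
      deriv n t * Z t + n t * deriv Z t] := by
    funext t
    refine HasDerivAt.deriv (hasDerivAt_pi.2 fun i => ?_)
    subst hc
    fin_cases i
    · simpa using d1 hn t
    · simpa [Pi.mul_def] using (d1 hn t).mul (d1 hY t)
    · simpa [Pi.mul_def] using (d1 hn t).mul (d1 hZ t)
  have hc2 : deriv (deriv c) t = ![deriv (deriv n) t,
      deriv (deriv n) t * Y t + deriv n t * deriv Y t +
        (deriv n t * deriv Y t + n t * deriv (deriv Y) t),
      deriv (deriv n) t * Z t + deriv n t * deriv Z t +
        (deriv n t * deriv Z t + n t * deriv (deriv Z) t)] := by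
    rw [hc1]
    refine HasDerivAt.deriv (hasDerivAt_pi.2 fun i => ?_)
    fin_cases i
    · simpa using d2 hn t
    · simpa [Pi.mul_def, Pi.add_def] using ((d2 hn t).mul (d1 hY t)).add ((d1 hn t).mul (d2 hY t))
    · simpa [Pi.mul_def, Pi.add_def] using ((d2 hn t).mul (d1 hZ t)).add ((d1 hn t).mul (d2 hZ t))
  rw [hc2, hc1, hc]
  simp only [det3, planarWronskian, Pi.smul_apply, smul_eq_mul, Matrix.cons_val]
  ring

lemma det3_toSphere {Y Z : ℝ → ℝ} (hY : ContDiff ℝ ∞ Y) (hZ : ContDiff ℝ ∞ Z) {t : ℝ}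
    (hW : planarWronskian Y Z t ≠ 0) {c : ℝ → Fin 3 → ℝ}
    (hc : c =ᶠ[𝓝 t] fun τ => toSphere (Y τ, Z τ)) :
    det3 (c t) (deriv c t) (deriv (deriv c) t) ≠ 0 := by
  rw [det3_congr hc]
  refine (det3_smul_affine (c := fun τ => toSphere (Y τ, Z τ)) (contDiff_inv_sqrt_one_add hY hZ)
    hY hZ rfl t).trans_ne ?_
  have : 0 < 1 + Y t ^ 2 + Z t ^ 2 := by positivity
  have := Real.sqrt_pos.2 this
  exact mul_ne_zero (by positivity) hW

lemma exists_pos_smooth_eq_self : ∃ ψ : ℝ → ℝ, ContDiff ℝ ∞ ψ ∧ (∀ x, 0 < ψ x) ∧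
    ∀ x, 1 / 2 ≤ x → ψ x = x := by
  have hS : ContDiff ℝ ∞ Real.smoothTransition := Real.smoothTransition.contDiff
  refine ⟨fun x => Real.smoothTransition (4 * x - 1) * x +
    (1 - Real.smoothTransition (4 * x - 1)), by fun_prop, fun x => ?_, fun x hx => ?_⟩
  · rcases le_or_gt (4 * x - 1) 0 with h | h
    · simp [Real.smoothTransition.zero_of_nonpos h]
    · have h1 := Real.smoothTransition.pos_of_pos h
      have h2 := Real.smoothTransition.le_one (4 * x - 1)
      have : 0 < x := by linarith
      have := mul_pos h1 this
      simp only
      linarith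
  · simp [Real.smoothTransition.one_of_one_le (show 1 ≤ 4 * x - 1 by linarith)]

/-- A spherical curve through `(1, 0, 0)` is locally the central projection of a plane curve. -/
lemma exists_affine_coordinates {γ₀ : ℝ → Fin 3 → ℝ} (hγ₀ : ContDiff ℝ ∞ γ₀)
    (hsph : ∀ t ∈ Icc (-1 : ℝ) 1, norm3 (γ₀ t) = 1)
    (hbase : γ₀ 0 = ![1, 0, 0]) :
    ∃ Y Z : ℝ → ℝ, ContDiff ℝ ∞ Y ∧ ContDiff ℝ ∞ Z ∧ ∃ r > 0, ∀ t, |t| < r →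
      γ₀ t = γ₀ t 0 • ![1, Y t, Z t] ∧ γ₀ t = toSphere (Y t, Z t) := by
  obtain ⟨ψ, hψ, hψ0, hψ1⟩ := exists_pos_smooth_eq_self
  have hcomp : ∀ i, ContDiff ℝ ∞ fun t => γ₀ t i := contDiff_pi.1 hγ₀
  have ev : ∀ᶠ t in 𝓝 (0 : ℝ), 1 / 2 < γ₀ t 0 :=
    (hcomp 0).continuous.continuousAt.eventually_const_lt (by simp [hbase]; norm_num)
  obtain ⟨r, hr, h⟩ := Metric.eventually_nhds_iff.1 ev
  simp only [dist_zero_right, Real.norm_eq_abs] at h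
  have hquot : ∀ i, ContDiff ℝ ∞ fun t => γ₀ t i / ψ (γ₀ t 0) := fun i =>
    (hcomp i).div (hψ.comp (hcomp 0)) fun t => (hψ0 _).ne'
  refine ⟨_, _, hquot 1, hquot 2, min r 1, by positivity, fun t ht => ?_⟩
  have hx := h (ht.trans_le (min_le_left _ _))
  have hx0 : 0 < γ₀ t 0 := by linarith
  have ht1 : t ∈ Icc (-1 : ℝ) 1 := abs_le.1 (ht.le.trans (min_le_right _ _))
  rw [hψ1 _ hx.le]
  refine ⟨?_, (toSphere_div_eq_self (hsph t ht1) hx0).symm⟩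
  ext i
  fin_cases i <;> simp <;> field_simp

lemma hasDerivAt_toSphere {Y Z : ℝ → ℝ} (hY : ContDiff ℝ ∞ Y) (hZ : ContDiff ℝ ∞ Z) (t : ℝ) :
    HasDerivAt (fun τ => toSphere (Y τ, Z τ))
      (fderiv ℝ toSphere (Y t, Z t) (deriv Y t, deriv Z t)) t := by
  have h := (contDiff_toSphere.differentiable (by simp) (Y t, Z t)).hasFDerivAt
  exact h.comp_hasDerivAt (f := fun τ => (Y τ, Z τ)) t
    ((hY.differentiable (by simp) t).hasDerivAt.prodMk (hZ.differentiable (by simp) t).hasDerivAt)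

/-- The 1-jet of `toSphere` along a curve depends continuously on the 1-jet of the curve. -/
lemma exists_toSphere_jet_close (x₀ : (ℝ × ℝ) × (ℝ × ℝ)) {ε : ℝ} (hε : 0 < ε) :
    ∃ ρ > 0, ∀ x y, dist x x₀ < ρ → dist y x₀ < ρ →
      norm3 (toSphere x.1 - toSphere y.1) +
        norm3 (fderiv ℝ toSphere x.1 x.2 - fderiv ℝ toSphere y.1 y.2) ≤ ε := by
  have h1 : Continuous fun x : (ℝ × ℝ) × (ℝ × ℝ) => toSphere x.1 :=
    contDiff_toSphere.continuous.comp continuous_fst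
  have h2 : Continuous fun x : (ℝ × ℝ) × (ℝ × ℝ) => fderiv ℝ toSphere x.1 x.2 :=
    ((contDiff_toSphere.continuous_fderiv (by simp)).comp continuous_fst).clm_apply continuous_snd
  obtain ⟨ρ₁, hρ₁, H₁⟩ := Metric.continuousAt_iff.1 h1.continuousAt (ε / 8) (by positivity)
  obtain ⟨ρ₂, hρ₂, H₂⟩ := Metric.continuousAt_iff.1 h2.continuousAt (ε / 8) (by positivity)
  refine ⟨min ρ₁ ρ₂, lt_min hρ₁ hρ₂, fun x y hx hy => ?_⟩
  have a1 := dist_triangle_right (toSphere x.1) (toSphere y.1) (toSphere x₀.1)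
  have a2 := dist_triangle_right (fderiv ℝ toSphere x.1 x.2) (fderiv ℝ toSphere y.1 y.2)
    (fderiv ℝ toSphere x₀.1 x₀.2)
  have b1 := H₁ (hx.trans_le (min_le_left _ _))
  have b2 := H₁ (hy.trans_le (min_le_left _ _))
  have b3 := H₂ (hx.trans_le (min_le_right _ _))
  have b4 := H₂ (hy.trans_le (min_le_right _ _))
  have c1 := norm3_le_two_mul_norm (toSphere x.1 - toSphere y.1)
  have c2 := norm3_le_two_mul_norm (fderiv ℝ toSphere x.1 x.2 - fderiv ℝ toSphere y.1 y.2)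
  rw [← dist_eq_norm] at c1 c2
  linarith

lemma coords_of_inv_norm3_smul_eq {v : Fin 3 → ℝ} (h : (norm3 v)⁻¹ • v = ![0, 1, 0]) :
    0 < v 1 ∧ v 2 = 0 := by
  have h1 := congrFun h 1
  have h2 := congrFun h 2
  simp only [Pi.smul_apply, smul_eq_mul, Matrix.cons_val] at h1 h2
  have hn : 0 ≤ (norm3 v)⁻¹ := inv_nonneg.2 (Real.sqrt_nonneg _)
  have hn' : (norm3 v)⁻¹ ≠ 0 := fun h => by simp [h] at h1
  exact ⟨pos_of_mul_pos_right (h1 ▸ one_pos) hn,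
    (mul_eq_zero.1 h2).resolve_left hn'⟩

/-- The projection to the chart `x = 1` of a convex curve with horizontal tangent at `(1, 0, 0)` has
a nondegenerate tangency with the axis. -/
lemma affine_coordinates_jet {γ₀ : ℝ → Fin 3 → ℝ} (hγ₀ : ContDiff ℝ ∞ γ₀)
    (hdet : det3 (γ₀ 0) (deriv γ₀ 0) (deriv (deriv γ₀) 0) ≠ 0) (hbase : γ₀ 0 = ![1, 0, 0])
    (h1 : 0 < deriv γ₀ 0 1) (h2 : deriv γ₀ 0 2 = 0) {Y Z : ℝ → ℝ} (hY : ContDiff ℝ ∞ Y)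
    (hZ : ContDiff ℝ ∞ Z) (heq : γ₀ =ᶠ[𝓝 0] fun t => γ₀ t 0 • ![1, Y t, Z t]) :
    Z 0 = 0 ∧ deriv Z 0 = 0 ∧ 0 < deriv Y 0 ∧ deriv (deriv Z) 0 ≠ 0 := by
  have hcomp : ∀ i, ContDiff ℝ ∞ fun t => γ₀ t i := contDiff_pi.1 hγ₀
  have hdc : ∀ i, deriv γ₀ 0 i = deriv (fun t => γ₀ t i) 0 := fun i =>
    (hasDerivAt_pi.1 (hγ₀.differentiable (by simp) 0).hasDerivAt i).deriv.symm
  have e0 := heq.eq_of_nhds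
  have eY : Y 0 = 0 := by
    have := congrFun e0 1
    simpa [hbase] using this.symm
  have eZ : Z 0 = 0 := by
    have := congrFun e0 2
    simpa [hbase] using this.symm
  have hprod : ∀ f : ℝ → ℝ, ContDiff ℝ ∞ f → f 0 = 0 →
      deriv (fun t => γ₀ t 0 * f t) 0 = deriv f 0 := fun f hf hf0 => by
    have := (((hcomp 0).differentiable (by simp) 0).hasDerivAt.mul
      (hf.differentiable (by simp) 0).hasDerivAt).deriv
    simp only [Pi.mul_def] at this
    rw [this]
    simp [hf0, hbase]
  have dY : deriv γ₀ 0 1 = deriv Y 0 := by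
    rw [hdc, ← hprod Y hY eY]
    refine Filter.EventuallyEq.deriv_eq ?_
    filter_upwards [heq] with t ht
    simpa using congrFun ht 1
  have dZ : deriv γ₀ 0 2 = deriv Z 0 := by
    rw [hdc, ← hprod Z hZ eZ]
    refine Filter.EventuallyEq.deriv_eq ?_
    filter_upwards [heq] with t ht
    simpa using congrFun ht 2
  have hZ1 : deriv Z 0 = 0 := dZ ▸ h2
  refine ⟨eZ, hZ1, dY ▸ h1, fun h => hdet ?_⟩
  rw [det3_congr heq, det3_smul_affine (hcomp 0) hY hZ rfl]
  simp [planarWronskian, h, hZ1]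

/-- a convex spherical curve through (1,0,0) with unit tangent (0,1,0) at its
midpoint can be deformed, C¹-slightly and relative to the complement of a small interval,
to a family of curves convex away from t = 0 whose final member has ∞-order of contact
with the horizontal equator at t = 0. -/
theorem glueing_lemma_two
    (γ₀ : ℝ → Fin 3 → ℝ) (hγ₀ : ContDiff ℝ (⊤ : ℕ∞) γ₀)
    (hsph : ∀ t ∈ Set.Icc (-1:ℝ) 1, norm3 (γ₀ t) = 1)
    (hconv : ∀ t ∈ Set.Icc (-1:ℝ) 1, deriv γ₀ t ≠ 0 ∧
      det3 (γ₀ t) (deriv γ₀ t) (deriv (deriv γ₀) t) ≠ 0)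
    (hbase : γ₀ 0 = ![1, 0, 0])
    (htang : (norm3 (deriv γ₀ 0))⁻¹ • deriv γ₀ 0 = ![0, 1, 0]) :
    ∃ ε₀ > (0:ℝ), ∀ ε : ℝ, 0 < ε → ε ≤ ε₀ →
      ∃ γ : ℝ × ℝ → Fin 3 → ℝ,
        ContDiff ℝ (⊤ : ℕ∞) γ ∧
        (∀ t : ℝ, γ (0, t) = γ₀ t) ∧
        (∀ s ∈ Set.Icc (0:ℝ) 1, ∀ t ∈ Set.Icc (-1:ℝ) 1, norm3 (γ (s, t)) = 1) ∧
        (∀ s ∈ Set.Icc (0:ℝ) 1, ∀ t ∈ Set.Icc (-1:ℝ) 1,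
          norm3 (γ (s, t) - γ₀ t) +
            norm3 (deriv (fun τ => γ (s, τ)) t - deriv γ₀ t) ≤ ε) ∧
        (∀ s ∈ Set.Icc (0:ℝ) 1, ∀ t ∈ Set.Icc (-1:ℝ) 1, ε ≤ |t| → γ (s, t) = γ₀ t) ∧
        (∀ s ∈ Set.Icc (0:ℝ) 1,
          γ (s, 0) = ![1, 0, 0] ∧
          (norm3 (deriv (fun τ => γ (s, τ)) 0))⁻¹ • deriv (fun τ => γ (s, τ)) 0
            = ![0, 1, 0]) ∧
        (∀ s ∈ Set.Ioc (0:ℝ) 1,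
          (∀ t ∈ Set.Icc (-1:ℝ) 1, deriv (fun τ => γ (s, τ)) t ≠ 0) ∧
          (∀ t ∈ Set.Icc (-1:ℝ) 1, t ≠ 0 →
            det3 (γ (s, t)) (deriv (fun τ => γ (s, τ)) t)
              (deriv (deriv (fun τ => γ (s, τ))) t) ≠ 0)) ∧
        (∀ n : ℕ, iteratedDeriv n (fun t => γ (1, t) 2) 0 = 0) := by
  obtain ⟨hv1, hv2⟩ := coords_of_inv_norm3_smul_eq htang
  obtain ⟨Y, Z, hY, hZ, r, hr, hcoord⟩ := exists_affine_coordinates hγ₀ hsph hbase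
  have hnhds : ∀ a t : ℝ, |t| < a → {x : ℝ | |x| < a} ∈ 𝓝 t := fun a t ht =>
    (isOpen_lt continuous_abs continuous_const).mem_nhds ht
  have heq : γ₀ =ᶠ[𝓝 0] fun t => γ₀ t 0 • ![1, Y t, Z t] := by
    filter_upwards [hnhds r 0 (by simpa using hr)] with t ht using (hcoord t ht).1
  obtain ⟨hZ0, hZ1, hY1, hZ2⟩ :=
    affine_coordinates_jet hγ₀ (hconv 0 (by simp)).2 hbase hv1 hv2 hY hZ heq
  refine ⟨1, one_pos, fun ε hε _ => ?_⟩
  obtain ⟨ρ, hρ, hjet⟩ := exists_toSphere_jet_close ((Y 0, Z 0), (deriv Y 0, deriv Z 0)) hε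
  have hjetc : Continuous fun t => ((Y t, Z t), (deriv Y t, deriv Z t)) :=
    (hY.continuous.prodMk hZ.continuous).prodMk
      ((contDiff_infty_iff_deriv.1 hY).2.continuous.prodMk
        (contDiff_infty_iff_deriv.1 hZ).2.continuous)
  obtain ⟨r₁, hr₁, hnear⟩ := Metric.continuousAt_iff.1 (hjetc.continuousAt (x := 0)) (ρ / 2)
    (by positivity)
  simp only [dist_zero_right, Real.norm_eq_abs] at hnear
  obtain ⟨ε', hε', h_ε, h_r, h_r₁, h_ρ⟩ : ∃ ε' > 0, ε' ≤ ε ∧ ε' ≤ r ∧ ε' ≤ r₁ ∧ ε' ≤ ρ / 4 :=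
    ⟨min (min ε r) (min r₁ (ρ / 4)), by positivity,
      (min_le_left _ _).trans (min_le_left _ _), (min_le_left _ _).trans (min_le_right _ _),
      (min_le_right _ _).trans (min_le_left _ _), (min_le_right _ _).trans (min_le_right _ _)⟩
  obtain ⟨η, hη, hηε, q, hq, hqout, hqsmall, hq0, hq1, hflat, hW⟩ :=
    exists_flattening hY hZ hZ0 hZ1 hY1 hZ2 hε'
  set γ : ℝ × ℝ → Fin 3 → ℝ := fun p =>
    γ₀ p.2 + (toSphere (Y p.2, Z p.2 + p.1 * q p.2) - toSphere (Y p.2, Z p.2)) with hγ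
  have hU : ∀ s : ℝ, ContDiff ℝ ∞ fun τ => Z τ + s * q τ := fun s => by fun_prop
  have hout : ∀ s t, η / 2 ≤ |t| → γ (s, t) = γ₀ t := fun s t ht => by simp [hγ, hqout t ht]
  have hout' : ∀ s t, η ≤ |t| → (fun τ => γ (s, τ)) =ᶠ[𝓝 t] γ₀ := fun s t ht => by
    have : {x : ℝ | η / 2 < |x|} ∈ 𝓝 t :=
      (isOpen_lt continuous_const continuous_abs).mem_nhds (show η / 2 < |t| by linarith)
    filter_upwards [this] with τ hτ using hout s τ (le_of_lt hτ)
  have hin : ∀ s t, |t| < η → γ (s, t) = toSphere (Y t, Z t + s * q t) := fun s t ht => by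
    simp [hγ, (hcoord t (by linarith)).2.symm]
  have hin' : ∀ s t, |t| < η →
      (fun τ => γ (s, τ)) =ᶠ[𝓝 t] fun τ => toSphere (Y τ, Z τ + s * q τ) := fun s t ht => by
    filter_upwards [hnhds η t ht] with τ hτ using hin s τ hτ
  have hderiv : ∀ s t, |t| < η → deriv (fun τ => γ (s, τ)) t =
      fderiv ℝ toSphere (Y t, Z t + s * q t) (deriv Y t, deriv Z t + s * deriv q t) :=
    fun s t ht => by
      rw [(hin' s t ht).deriv_eq, (hasDerivAt_toSphere hY (hU s) t).deriv]
      have : deriv (fun τ => Z τ + s * q τ) t = deriv Z t + s * deriv q t :=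
        ((hZ.differentiable (by simp) t).hasDerivAt.add
          ((hq.differentiable (by simp) t).hasDerivAt.const_mul s)).deriv
      rw [this]
  have hderiv₀ : ∀ t, |t| < η → deriv γ₀ t =
      fderiv ℝ toSphere (Y t, Z t) (deriv Y t, deriv Z t) := fun t ht => by
    have h0 : (fun τ => γ (0, τ)) = γ₀ := by ext; simp [hγ]
    simpa [h0] using hderiv 0 t ht
  have htan : ∀ s, (norm3 (deriv (fun τ => γ (s, τ)) 0))⁻¹ • deriv (fun τ => γ (s, τ)) 0
      = ![0, 1, 0] := fun s => by
    have h0 : |(0 : ℝ)| < η := by simpa using hη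
    rw [hderiv s 0 h0, hq0, hq1, mul_zero, add_zero, add_zero, ← hderiv₀ 0 h0, htang]
  have hdet : ∀ s ∈ Ioc (0 : ℝ) 1, ∀ t ∈ Icc (-1 : ℝ) 1, t ≠ 0 →
      det3 (γ (s, t)) (deriv (fun τ => γ (s, τ)) t)
        (deriv (deriv (fun τ => γ (s, τ))) t) ≠ 0 := fun s hs t ht ht0 => by
    rcases lt_or_ge |t| η with h | h
    · exact det3_toSphere hY (hU s) (hW s hs t h ht0) (hin' s t h)
    · exact (det3_congr (hout' s t h)).trans_ne (hconv t ht).2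
  refine ⟨γ, ?_, fun t => by simp [hγ], fun s _ t ht => ?_, fun s hs t _ => ?_,
    fun s _ t _ h => hout s t (by linarith), fun s _ => ⟨?_, htan s⟩,
    fun s hs => ⟨fun t ht => ?_, hdet s hs⟩, fun n => ?_⟩
  · have := contDiff_toSphere
    fun_prop
  · rcases lt_or_ge |t| η with h | h
    · rw [hin s t h, norm3_toSphere]
    · rw [hout s t (by linarith), hsph t ht]
  · rcases lt_or_ge |t| η with h | h
    · rw [hin s t h, hderiv s t h, (hcoord t (by linarith)).2, hderiv₀ t h]
      have hd := hnear (x := t) (by linarith)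
      refine hjet ((Y t, Z t + s * q t), (deriv Y t, deriv Z t + s * deriv q t))
        ((Y t, Z t), (deriv Y t, deriv Z t)) ?_ (by linarith)
      have hmul : ∀ a : ℝ, |a| ≤ ε' → |s * a| ≤ ρ / 4 := fun a ha => by
        rw [abs_mul, abs_of_nonneg hs.1]
        nlinarith [hs.1, hs.2, abs_nonneg a]
      have hclose : dist ((Y t, Z t + s * q t), (deriv Y t, deriv Z t + s * deriv q t))
          ((Y t, Z t), (deriv Y t, deriv Z t)) ≤ ρ / 4 := by
        simp only [Prod.dist_eq, Real.dist_eq, sub_self, abs_zero, add_sub_cancel_left]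
        have h1 := hmul _ (hqsmall t h).1
        have h2 := hmul _ (hqsmall t h).2
        exact max_le (max_le (by positivity) h1) (max_le (by positivity) h2)
      refine (dist_triangle _ _ _).trans_lt (lt_of_le_of_lt (add_le_add hclose hd.le) ?_)
      linarith
    · rw [hout s t (by linarith), (hout' s t h).deriv_eq, sub_self, sub_self, norm3_zero]
      linarith
  · simp [hγ, hq0, hbase]
  · rcases eq_or_ne t 0 with rfl | ht0
    · intro h
      have := congrFun (htan s) 1
      simp [h] at this
    · intro h
      exact hdet s hs t ht ht0 (by simp [h, det3])
  · have : (fun t => γ (1, t) 2) =ᶠ[𝓝 0] fun t =>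
        (√(1 + Y t ^ 2 + (Z t + q t) ^ 2))⁻¹ * (Z t + q t) := by
      filter_upwards [hnhds η 0 (by simpa using hη)] with t ht
      rw [hin 1 t ht]
      simp [toSphere]
    rw [this.iteratedDeriv_eq]
    exact iteratedDeriv_mul_eq_zero (contDiff_inv_sqrt_one_add hY (hZ.add hq)) (hZ.add hq) hflat n
end

section
/- Let X : ℝ³ × ℝ → ℝ³ be smooth with ‖X(p,t)‖ = 1 for all (p,t). Regard X̃(p,t) = (X(p,t), 0) as a vector field on ℝ⁴ = ℝ³ × ℝ and let T be the constant vector field (0,0,0,1). Fix q = (p,t₀) and assume ∂ₜX(q) ≠ 0 and at least one of: (1) det(X(q), ∂ₜX(q), ∂ₜ²X(q)) ≠ 0; (2) det(X(q), ∂ₜX(q), B(q)) ≠ 0, where B(p,t) = [X(·,t), ∂ₜX(·,t)](p) is the Lie bracket of the vector fields X(·,t) and ∂ₜX(·,t) on ℝ³ at frozen t. Then the vectors T, X̃(q), [T,X̃](q) are linearly independent, and the vectors T, X̃(q), [T,X̃](q), [T,[T,X̃]](q), [X̃,[T,X̃]](q) span ℝ⁴; that is, the 2-plane distribution spanned by T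 and X̃ satisfies the Engel conditions at q. -/
open Real Set

/-- Lie bracket of vector fields on ℝ³: [v,w](p) = Dw(p)(v(p)) − Dv(p)(w(p)). -/
noncomputable def lie3 (v w : (Fin 3 → ℝ) → (Fin 3 → ℝ)) (p : Fin 3 → ℝ) : Fin 3 → ℝ :=
  fderiv ℝ w p (v p) - fderiv ℝ v p (w p)

/-- Lie bracket of vector fields on ℝ⁴ = ℝ³ × ℝ. -/
noncomputable def lie4 (V W : ((Fin 3 → ℝ) × ℝ) → ((Fin 3 → ℝ) × ℝ))
    (q : (Fin 3 → ℝ) × ℝ) : (Fin 3 → ℝ) × ℝ :=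
  fderiv ℝ W q (V q) - fderiv ℝ V q (W q)

theorem det3_cramer (a u v w : Fin 3 → ℝ) :
    det3 u v w • a = det3 a v w • u + det3 u a w • v + det3 u v a • w := by
  ext i
  fin_cases i <;> simp [det3] <;> ring

theorem deriv_snd_eq_fderiv {F : (Fin 3 → ℝ) × ℝ → (Fin 3 → ℝ)} (hF : Differentiable ℝ F)
    (q : (Fin 3 → ℝ) × ℝ) : deriv (fun t => F (q.1, t)) q.2 = fderiv ℝ F q (0, 1) :=
  ((hF q).hasFDerivAt.comp_hasDerivAt q.2
    ((hasDerivAt_const q.2 q.1).prodMk (hasDerivAt_id q.2))).deriv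

/-- Bracketing with the constant field `∂ₜ` differentiates a horizontal field in `t`. -/
theorem lie4_const_horizontal {F : (Fin 3 → ℝ) × ℝ → (Fin 3 → ℝ)} (hF : Differentiable ℝ F) :
    lie4 (fun _ => (0, 1)) (fun q => (F q, 0)) =
      fun q => (deriv (fun t => F (q.1, t)) q.2, 0) := by
  funext q
  have hlift := (hF q).hasFDerivAt.prodMk (hasFDerivAt_const (0 : ℝ) q)
  simp only [lie4, hlift.fderiv]
  simp [deriv_snd_eq_fderiv hF]

/-- The bracket of two horizontal fields is the bracket of their restrictions to a slice. -/
theorem lie4_horizontal {F G : (Fin 3 → ℝ) × ℝ → (Fin 3 → ℝ)} (hF : Differentiable ℝ F)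
    (hG : Differentiable ℝ G) (p : Fin 3 → ℝ) (t : ℝ) :
    lie4 (fun q => (F q, 0)) (fun q => (G q, 0)) (p, t) =
      (lie3 (fun y => F (y, t)) (fun y => G (y, t)) p, 0) := by
  have hslice := hasFDerivAt_prodMk_left (𝕜 := ℝ) p t
  have lift_fderiv {H : (Fin 3 → ℝ) × ℝ → (Fin 3 → ℝ)} (hH : Differentiable ℝ H) :=
    ((hH (p, t)).hasFDerivAt.prodMk (hasFDerivAt_const (0 : ℝ) (p, t))).fderiv
  have slice_fderiv {H : (Fin 3 → ℝ) × ℝ → (Fin 3 → ℝ)} (hH : Differentiable ℝ H) :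
      fderiv ℝ (fun y => H (y, t)) p = _ :=
    ((hH (p, t)).hasFDerivAt.comp p hslice).fderiv
  simp [lie4, lie3, lift_fderiv hF, lift_fderiv hG, slice_fderiv hF, slice_fderiv hG]

theorem contDiff_deriv_snd {F : (Fin 3 → ℝ) × ℝ → (Fin 3 → ℝ)}
    (hF : ContDiff ℝ (⊤ : ℕ∞) F) :
    ContDiff ℝ (⊤ : ℕ∞) fun q : (Fin 3 → ℝ) × ℝ => deriv (fun t => F (q.1, t)) q.2 := by
  simp only [deriv_snd_eq_fderiv (hF.differentiable (by simp))]
  exact (hF.fderiv_right (by simp)).clm_apply contDiff_const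

theorem linearIndependent_of_det3_ne_zero {u v w : Fin 3 → ℝ} (h : det3 u v w ≠ 0) :
    LinearIndependent ℝ
      ![((0 : Fin 3 → ℝ), (1 : ℝ)), (u, (0 : ℝ)), (v, (0 : ℝ))] := by
  rw [Fintype.linearIndependent_iff]
  intro c hc
  simp only [Fin.sum_univ_three, Prod.ext_iff] at hc
  obtain ⟨hhor, hvert⟩ := hc
  simp at hhor hvert
  have hcoord (i : Fin 3) : c 1 * u i + c 2 * v i = 0 := by simpa using congrFun hhor i
  have hu : c 1 * det3 u v w = 0 := by
    unfold det3
    linear_combination (v 1 * w 2 - v 2 * w 1) * hcoord 0 -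
      (v 0 * w 2 - v 2 * w 0) * hcoord 1 + (v 0 * w 1 - v 1 * w 0) * hcoord 2
  have hv : c 2 * det3 u v w = 0 := by
    unfold det3
    linear_combination -(u 1 * w 2 - u 2 * w 1) * hcoord 0 +
      (u 0 * w 2 - u 2 * w 0) * hcoord 1 - (u 0 * w 1 - u 1 * w 0) * hcoord 2
  intro i
  fin_cases i
  · exact hvert
  · exact (mul_eq_zero.mp hu).resolve_right h
  · exact (mul_eq_zero.mp hv).resolve_right h

theorem eq_top_of_det3_ne_zero {u v w : Fin 3 → ℝ} (h : det3 u v w ≠ 0)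
    {S : Submodule ℝ ((Fin 3 → ℝ) × ℝ)} (hT : ((0 : Fin 3 → ℝ), (1 : ℝ)) ∈ S)
    (hu : (u, (0 : ℝ)) ∈ S) (hv : (v, (0 : ℝ)) ∈ S) (hw : (w, (0 : ℝ)) ∈ S) : S = ⊤ := by
  refine S.eq_top_iff'.mpr fun ⟨a, s⟩ => ?_
  have ha : (a, (0 : ℝ)) ∈ S := by
    rw [← S.smul_mem_iff h]
    have := S.add_mem (S.add_mem (S.smul_mem (det3 a v w) hu) (S.smul_mem (det3 u a w) hv))
      (S.smul_mem (det3 u v a) hw)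
    simpa [det3_cramer a u v w] using this
  simpa using S.add_mem ha (S.smul_mem s hT)

/-- Proposition `EngelCurves`: if the curve t ↦ X(p,t) has nonvanishing
velocity and either no inflection point (condition 1) or spans a contact structure with
its derivative (condition 2), then the 2-plane field spanned by T = ∂ₜ and X̃ satisfies
the Engel conditions at q = (p,t₀). -/
theorem engel_from_curves
    (X : (Fin 3 → ℝ) → ℝ → (Fin 3 → ℝ))
    (hX : ContDiff ℝ (⊤ : ℕ∞) (fun q : (Fin 3 → ℝ) × ℝ => X q.1 q.2))
    (hunit : ∀ (p : Fin 3 → ℝ) (t : ℝ), norm3 (X p t) = 1)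
    (T Xtil : ((Fin 3 → ℝ) × ℝ) → ((Fin 3 → ℝ) × ℝ))
    (hT : T = fun _ => ((0 : Fin 3 → ℝ), (1 : ℝ)))
    (hXtil : Xtil = fun q => (X q.1 q.2, (0 : ℝ)))
    (p : Fin 3 → ℝ) (t₀ : ℝ)
    (hvel : deriv (X p) t₀ ≠ 0)
    (hcond :
      det3 (X p t₀) (deriv (X p) t₀) (deriv (deriv (X p)) t₀) ≠ 0 ∨
      det3 (X p t₀) (deriv (X p) t₀)
        (lie3 (fun y => X y t₀) (fun y => deriv (X y) t₀) p) ≠ 0) :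
    LinearIndependent ℝ ![T (p, t₀), Xtil (p, t₀), lie4 T Xtil (p, t₀)] ∧
    Submodule.span ℝ
      ({T (p, t₀), Xtil (p, t₀), lie4 T Xtil (p, t₀),
        lie4 T (lie4 T Xtil) (p, t₀), lie4 Xtil (lie4 T Xtil) (p, t₀)} :
        Set ((Fin 3 → ℝ) × ℝ)) = ⊤ := by
  subst hT hXtil
  have hF := hX.differentiable (by simp)
  have hG := (contDiff_deriv_snd hX).differentiable (by simp)
  rw [lie4_const_horizontal hF, lie4_const_horizontal hG, lie4_horizontal hF hG]
  rcases hcond with h | h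
  · exact ⟨linearIndependent_of_det3_ne_zero h, eq_top_of_det3_ne_zero h
      (Submodule.subset_span (by simp)) (Submodule.subset_span (by simp))
      (Submodule.subset_span (by simp)) (Submodule.subset_span (by simp))⟩
  · exact ⟨linearIndependent_of_det3_ne_zero h, eq_top_of_det3_ne_zero h
      (Submodule.subset_span (by simp)) (Submodule.subset_span (by simp))
      (Submodule.subset_span (by simp)) (Submodule.subset_span (by simp))⟩
end

section
/- Let V₁, V₂, V₃ be smooth vector fields on an open set U ⊆ ℝ⁴ = ℝ³ × ℝ such that for every q ∈ U: (i) V₁(q), V₂(q), V₃(q) are linearly independent; (ii) the vectors V₁(q), V₂(q), V₃(q) together with [V₁,V₂](q), [V₁,V₃](q), [V₂,V₃](q) span ℝ⁴ (the rank-3 distribution E = span{V₁,V₂,V₃} is even-contact); (iii) [V₁,V₂](q) and [V₁,V₃](q) lie in span{V₁(q), V₂(q), V₃(q)} (V₁ spans the kernel of E). Let N = ℝ³ × {0} and suppose that along N ∩ U the fields V₂ and V₃ are tangent to N (their fourth components vanish on N) while V₁ is transverse to N (its fourth component is nonzero on N). Write v₂, v₃ : N ∩ U → ℝ³ for the vector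 fields on ℝ³ given by the first three components of V₂, V₃ restricted to N. Then for every p ∈ N ∩ U the bracket [v₂,v₃](p) does not lie in span{v₂(p), v₃(p)}; i.e., the plane field spanned by v₂ and v₃ is a contact structure on N ∩ U. -/
open Real Set

/-- The slice at height `0` of an open subset of `ℝ³ × ℝ` is a neighbourhood of its points. -/
lemma slice_mem_nhds {U : Set ((Fin 3 → ℝ) × ℝ)} (hU : IsOpen U) {p : Fin 3 → ℝ}
    (hp : (p, (0 : ℝ)) ∈ U) : ∀ᶠ y in nhds p, (y, (0 : ℝ)) ∈ U :=
  (hU.preimage (by fun_prop : Continuous fun y : Fin 3 → ℝ => (y, (0 : ℝ)))).mem_nhds hp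

lemma hasFDerivAt_slice {V : ((Fin 3 → ℝ) × ℝ) → ((Fin 3 → ℝ) × ℝ)} {p : Fin 3 → ℝ}
    (hV : DifferentiableAt ℝ V (p, 0)) :
    HasFDerivAt (fun y => V (y, 0))
      ((fderiv ℝ V (p, 0)).comp (ContinuousLinearMap.inl ℝ (Fin 3 → ℝ) ℝ)) p :=
  hV.hasFDerivAt.comp p (hasFDerivAt_prodMk_left p (0 : ℝ))

/-- In directions tangent to the slice, the derivative of a field tangent to the slice is the
derivative of its restriction. -/
lemma fderiv_apply_of_tangent {V : ((Fin 3 → ℝ) × ℝ) → ((Fin 3 → ℝ) × ℝ)} {p : Fin 3 → ℝ}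
    (hV : DifferentiableAt ℝ V (p, 0)) (hT : ∀ᶠ y in nhds p, (V (y, 0)).2 = 0)
    {u : (Fin 3 → ℝ) × ℝ} (hu : u.2 = 0) :
    fderiv ℝ V (p, 0) u = (fderiv ℝ (fun y => (V (y, 0)).1) p u.1, 0) := by
  have hu' : u = (u.1, 0) := Prod.ext rfl hu
  have h := hasFDerivAt_slice hV
  refine Prod.ext ?_ ?_
  · rw [h.fst.fderiv, hu']
    simp
  · have h0 : HasFDerivAt (fun y => (V (y, 0)).2) (0 : (Fin 3 → ℝ) →L[ℝ] ℝ) p :=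
      (hasFDerivAt_const (0 : ℝ) p).congr_of_eventuallyEq hT
    have := DFunLike.congr_fun (h.snd.unique h0) u.1
    rw [hu']
    simpa using this

/-- The bracket of two fields tangent to the slice is the bracket of their restrictions. -/
lemma lie4_eq_lie3_of_tangent {V W : ((Fin 3 → ℝ) × ℝ) → ((Fin 3 → ℝ) × ℝ)} {p : Fin 3 → ℝ}
    (hV : DifferentiableAt ℝ V (p, 0)) (hW : DifferentiableAt ℝ W (p, 0))
    (hVT : ∀ᶠ y in nhds p, (V (y, 0)).2 = 0) (hWT : ∀ᶠ y in nhds p, (W (y, 0)).2 = 0) :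
    lie4 V W (p, 0) = (lie3 (fun y => (V (y, 0)).1) (fun y => (W (y, 0)).1) p, 0) := by
  rw [lie4, lie3, fderiv_apply_of_tangent hW hWT hVT.self_of_nhds,
    fderiv_apply_of_tangent hV hVT hWT.self_of_nhds]
  simp

lemma span_triple_ne_top (a b c : (Fin 3 → ℝ) × ℝ) :
    Submodule.span ℝ ({a, b, c} : Set ((Fin 3 → ℝ) × ℝ)) ≠ ⊤ := by
  intro h
  have hcard := finrank_range_le_card (R := ℝ) ![a, b, c]
  have hrange : Set.range ![a, b, c] = {a, b, c} := by
    simp only [Matrix.range_cons, Matrix.range_empty, Set.singleton_union, Set.union_empty]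
  rw [Set.finrank, hrange, h, finrank_top] at hcard
  simp at hcard

/-- an even-contact structure E = span{V₁,V₂,V₃} with kernel V₁ induces a
contact structure on a hypersurface N = ℝ³ × {0} transverse to the kernel. -/
theorem evenContact_induces_contact
    (U : Set ((Fin 3 → ℝ) × ℝ)) (hU : IsOpen U)
    (V₁ V₂ V₃ : ((Fin 3 → ℝ) × ℝ) → ((Fin 3 → ℝ) × ℝ))
    (hV₁ : ContDiffOn ℝ (⊤ : ℕ∞) V₁ U) (hV₂ : ContDiffOn ℝ (⊤ : ℕ∞) V₂ U) (hV₃ : ContDiffOn ℝ (⊤ : ℕ∞) V₃ U)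
    (hind : ∀ q ∈ U, LinearIndependent ℝ ![V₁ q, V₂ q, V₃ q])
    (heven : ∀ q ∈ U,
      Submodule.span ℝ
        ({V₁ q, V₂ q, V₃ q, lie4 V₁ V₂ q, lie4 V₁ V₃ q, lie4 V₂ V₃ q} :
          Set ((Fin 3 → ℝ) × ℝ)) = ⊤)
    (hker : ∀ q ∈ U,
      lie4 V₁ V₂ q ∈ Submodule.span ℝ ({V₁ q, V₂ q, V₃ q} : Set ((Fin 3 → ℝ) × ℝ)) ∧
      lie4 V₁ V₃ q ∈ Submodule.span ℝ ({V₁ q, V₂ q, V₃ q} : Set ((Fin 3 → ℝ) × ℝ)))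
    (htan : ∀ q ∈ U, q.2 = 0 → (V₂ q).2 = 0 ∧ (V₃ q).2 = 0 ∧ (V₁ q).2 ≠ 0) :
    ∀ p : Fin 3 → ℝ, (p, (0:ℝ)) ∈ U →
      lie3 (fun y => (V₂ (y, 0)).1) (fun y => (V₃ (y, 0)).1) p ∉
        Submodule.span ℝ ({(V₂ (p, 0)).1, (V₃ (p, 0)).1} : Set (Fin 3 → ℝ)) := by
  intro p hp
  obtain ⟨h2, h3, -⟩ := htan _ hp rfl
  have hd₂ := (hV₂.contDiffAt (hU.mem_nhds hp)).differentiableAt (by simp)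
  have hd₃ := (hV₃.contDiffAt (hU.mem_nhds hp)).differentiableAt (by simp)
  have hslice := slice_mem_nhds hU hp
  have hT₂ : ∀ᶠ y in nhds p, (V₂ (y, 0)).2 = 0 := by
    filter_upwards [hslice] with y hy using (htan _ hy rfl).1
  have hT₃ : ∀ᶠ y in nhds p, (V₃ (y, 0)).2 = 0 := by
    filter_upwards [hslice] with y hy using (htan _ hy rfl).2.1
  intro hmem
  have hbr : lie4 V₂ V₃ (p, 0) ∈
      Submodule.span ℝ ({V₁ (p, 0), V₂ (p, 0), V₃ (p, 0)} : Set ((Fin 3 → ℝ) × ℝ)) := by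
    rw [lie4_eq_lie3_of_tangent hd₂ hd₃ hT₂ hT₃]
    obtain ⟨s, t, hst⟩ := Submodule.mem_span_pair.1 hmem
    rw [Submodule.mem_span_triple]
    refine ⟨0, s, t, Prod.ext ?_ ?_⟩
    · simpa using hst
    · simp [h2, h3]
  have hle : Submodule.span ℝ ({V₁ (p, 0), V₂ (p, 0), V₃ (p, 0), lie4 V₁ V₂ (p, 0),
      lie4 V₁ V₃ (p, 0), lie4 V₂ V₃ (p, 0)} : Set ((Fin 3 → ℝ) × ℝ)) ≤
      Submodule.span ℝ ({V₁ (p, 0), V₂ (p, 0), V₃ (p, 0)} : Set ((Fin 3 → ℝ) × ℝ)) := by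
    rw [Submodule.span_le]
    rintro x (rfl | rfl | rfl | rfl | rfl | rfl)
    · exact Submodule.subset_span (by simp)
    · exact Submodule.subset_span (by simp)
    · exact Submodule.subset_span (by simp)
    · exact (hker _ hp).1
    · exact (hker _ hp).2
    · exact hbr
  rw [heven _ hp, top_le_iff] at hle
  exact span_triple_ne_top _ _ _ hle
end

section
/- Let Y, Z : ℝ³ → ℝ³ be smooth vector fields such that Y(p), Z(p), [Y,Z](p) are linearly independent for every p (so the plane field span{Y,Z} is a contact structure on ℝ³). Let c : ℝ³ × ℝ → ℝ be smooth and define vector fields on ℝ⁴ = ℝ³ × ℝ: T = (0,0,0,1), Ỹ(p,t) = (Y(p),0), Z̃(p,t) = (Z(p),0), and X = cos(c)·Ỹ + sin(c)·Z̃. Then for every q = (p,t) the following are equivalent: (a) ∂ₜc(q) > 0; (b) the triple (T, X(q), [T,X](q)) is a basis of E_q := span{T, Ỹ(q), Z̃(q)} defining the same orientation of E_q as the basis (T, Ỹ(q), Z̃(q)), and the four vectors T, X(q), [T,X](q), [X,[T,X]](q) span ℝ⁴. That is, the angular model D(c) = span{T, X} is an oriented Engel structure at q if and only if ∂ₜc(q)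 > 0. -/
open Real Set

/-- The derivative of `a Ỹ + b Z̃`, the lift to ℝ⁴ of a combination of fields on ℝ³. -/
lemma fderiv_lift_combination {Y Z : (Fin 3 → ℝ) → (Fin 3 → ℝ)} {a b : ((Fin 3 → ℝ) × ℝ) → ℝ}
    {q : (Fin 3 → ℝ) × ℝ}
    (hY : DifferentiableAt ℝ Y q.1) (hZ : DifferentiableAt ℝ Z q.1)
    (ha : DifferentiableAt ℝ a q) (hb : DifferentiableAt ℝ b q) (v : (Fin 3 → ℝ) × ℝ) :
    fderiv ℝ (fun q : (Fin 3 → ℝ) × ℝ => a q • (Y q.1, (0 : ℝ)) + b q • (Z q.1, (0 : ℝ))) q v =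
      (a q • fderiv ℝ Y q.1 v.1 + fderiv ℝ a q v • Y q.1 +
        (b q • fderiv ℝ Z q.1 v.1 + fderiv ℝ b q v • Z q.1), 0) := by
  have lift : ∀ {V : (Fin 3 → ℝ) → (Fin 3 → ℝ)}, DifferentiableAt ℝ V q.1 →
      HasFDerivAt (fun q : (Fin 3 → ℝ) × ℝ => (V q.1, (0 : ℝ)))
        (((fderiv ℝ V q.1).comp (ContinuousLinearMap.fst ℝ _ _)).prod 0) q := fun hV =>
    (hV.hasFDerivAt.comp q hasFDerivAt_fst).prodMk (hasFDerivAt_const (0 : ℝ) q)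
  have h := (ha.hasFDerivAt.smul (lift hY)).add (hb.hasFDerivAt.smul (lift hZ))
  refine (congrArg (fun L => L v) h.fderiv).trans ?_
  simp

/-- The bracket of two combinations of `Ỹ`, `Z̃`, modulo the span of `Ỹ` and `Z̃`. -/
lemma lie4_lift_combination {Y Z : (Fin 3 → ℝ) → (Fin 3 → ℝ)}
    {a b a' b' : ((Fin 3 → ℝ) × ℝ) → ℝ} {q : (Fin 3 → ℝ) × ℝ}
    (hY : DifferentiableAt ℝ Y q.1) (hZ : DifferentiableAt ℝ Z q.1)
    (ha : DifferentiableAt ℝ a q) (hb : DifferentiableAt ℝ b q)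
    (ha' : DifferentiableAt ℝ a' q) (hb' : DifferentiableAt ℝ b' q) :
    ∃ r s : ℝ,
      lie4 (fun q => a q • (Y q.1, (0 : ℝ)) + b q • (Z q.1, (0 : ℝ)))
        (fun q => a' q • (Y q.1, (0 : ℝ)) + b' q • (Z q.1, (0 : ℝ))) q =
      (r • Y q.1 + s • Z q.1 + (a q * b' q - a' q * b q) • lie3 Y Z q.1, 0) := by
  set V : (Fin 3 → ℝ) × ℝ := a q • (Y q.1, (0 : ℝ)) + b q • (Z q.1, (0 : ℝ))
  set V' : (Fin 3 → ℝ) × ℝ := a' q • (Y q.1, (0 : ℝ)) + b' q • (Z q.1, (0 : ℝ))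
  refine ⟨fderiv ℝ a' q V - fderiv ℝ a q V', fderiv ℝ b' q V - fderiv ℝ b q V', ?_⟩
  have hV : V.1 = a q • Y q.1 + b q • Z q.1 := by simp [V]
  have hV' : V'.1 = a' q • Y q.1 + b' q • Z q.1 := by simp [V']
  rw [lie4, fderiv_lift_combination hY hZ ha hb, fderiv_lift_combination hY hZ ha' hb', lie3]
  change (_ • fderiv ℝ Y q.1 V.1 + fderiv ℝ a' q V • _ +
      (_ • fderiv ℝ Z q.1 V.1 + fderiv ℝ b' q V • _), (0 : ℝ)) -
    (_ • fderiv ℝ Y q.1 V'.1 + fderiv ℝ a q V' • _ +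
      (_ • fderiv ℝ Z q.1 V'.1 + fderiv ℝ b q V' • _), (0 : ℝ)) = _
  rw [hV, hV']
  clear_value V V'
  simp only [map_add, map_smul]
  ext1
  · simp only [Prod.fst_sub]
    module
  · simp

/-- Four vectors of ℝ⁴ adapted to a frame of ℝ³ span when the diagonal coefficients are nonzero. -/
lemma span_adapted_frame_eq_top {y z l : Fin 3 → ℝ} (h : LinearIndependent ℝ ![y, z, l])
    {f θ : ℝ} (hf : f ≠ 0) (r s : ℝ) :
    Submodule.span ℝ
      ({((0 : Fin 3 → ℝ), (1 : ℝ)), cos θ • (y, (0 : ℝ)) + sin θ • (z, (0 : ℝ)),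
        (-(f * sin θ)) • (y, (0 : ℝ)) + (f * cos θ) • (z, (0 : ℝ)),
        (r • y + s • z + f • l, (0 : ℝ))} : Set ((Fin 3 → ℝ) × ℝ)) = ⊤ := by
  set S := Submodule.span ℝ
      ({((0 : Fin 3 → ℝ), (1 : ℝ)), cos θ • (y, (0 : ℝ)) + sin θ • (z, (0 : ℝ)),
        (-(f * sin θ)) • (y, (0 : ℝ)) + (f * cos θ) • (z, (0 : ℝ)),
        (r • y + s • z + f • l, (0 : ℝ))} : Set ((Fin 3 → ℝ) × ℝ))
  have h1 : ((0 : Fin 3 → ℝ), (1 : ℝ)) ∈ S := Submodule.subset_span (by simp)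
  have h2 : cos θ • (y, (0 : ℝ)) + sin θ • (z, (0 : ℝ)) ∈ S := Submodule.subset_span (by simp)
  have h3 : (-(f * sin θ)) • (y, (0 : ℝ)) + (f * cos θ) • (z, (0 : ℝ)) ∈ S :=
    Submodule.subset_span (by simp)
  have h4 : (r • y + s • z + f • l, (0 : ℝ)) ∈ S := Submodule.subset_span (by simp)
  have hy : (y, (0 : ℝ)) ∈ S := by
    convert S.sub_mem (S.smul_mem (cos θ) h2) (S.smul_mem (f⁻¹ * sin θ) h3) using 1
    match_scalars
    · field_simp
      linear_combination -(sin_sq_add_cos_sq θ)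
    · field_simp
      ring
  have hz : (z, (0 : ℝ)) ∈ S := by
    convert S.add_mem (S.smul_mem (sin θ) h2) (S.smul_mem (f⁻¹ * cos θ) h3) using 1
    match_scalars
    · field_simp
      linear_combination -(sin_sq_add_cos_sq θ)
    · field_simp
      ring
  have hl : (l, (0 : ℝ)) ∈ S := by
    convert S.smul_mem f⁻¹ (S.sub_mem (S.sub_mem h4 (S.smul_mem r hy)) (S.smul_mem s hz)) using 1
    ext1
    · change l = f⁻¹ • (r • y + s • z + f • l - r • y - s • z)
      match_scalars <;> field_simp <;> ring
    · simp
  have htop : Submodule.span ℝ (Set.range ![y, z, l]) = ⊤ :=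
    h.span_eq_top_of_card_eq_finrank (by simp)
  have hfst : S.comap (LinearMap.inl ℝ (Fin 3 → ℝ) ℝ) = ⊤ := by
    rw [eq_top_iff, ← htop, Submodule.span_le]
    rintro _ ⟨i, rfl⟩
    fin_cases i
    · exact hy
    · exact hz
    · exact hl
  rw [eq_top_iff]
  rintro ⟨u, t⟩ -
  have hu : (u, (0 : ℝ)) ∈ S := by
    have : u ∈ S.comap (LinearMap.inl ℝ (Fin 3 → ℝ) ℝ) := hfst ▸ Submodule.mem_top
    exact this
  convert S.add_mem hu (S.smul_mem t h1) using 1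
  simp

/-- the angular model D(c) = span{T, X}, with
X = cos(c)·Ỹ + sin(c)·Z̃ over a contact frame (Y,Z) of ℝ³, is an oriented Engel structure
at q if and only if ∂ₜc(q) > 0. -/
theorem angular_model_engel_iff
    (Y Z : (Fin 3 → ℝ) → (Fin 3 → ℝ))
    (hY : ContDiff ℝ (⊤ : ℕ∞) Y) (hZ : ContDiff ℝ (⊤ : ℕ∞) Z)
    (hcontact : ∀ p : Fin 3 → ℝ, LinearIndependent ℝ ![Y p, Z p, lie3 Y Z p])
    (c : ((Fin 3 → ℝ) × ℝ) → ℝ) (hc : ContDiff ℝ (⊤ : ℕ∞) c)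
    (T Ytil Ztil X : ((Fin 3 → ℝ) × ℝ) → ((Fin 3 → ℝ) × ℝ))
    (hT : T = fun _ => ((0 : Fin 3 → ℝ), (1 : ℝ)))
    (hYtil : Ytil = fun q => (Y q.1, (0 : ℝ)))
    (hZtil : Ztil = fun q => (Z q.1, (0 : ℝ)))
    (hX : X = fun q => Real.cos (c q) • Ytil q + Real.sin (c q) • Ztil q)
    (q : (Fin 3 → ℝ) × ℝ) :
    0 < deriv (fun τ => c (q.1, τ)) q.2 ↔
      ((∃ M : Matrix (Fin 3) (Fin 3) ℝ, 0 < M.det ∧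
          ∀ i : Fin 3,
            (![T q, X q, lie4 T X q]) i =
              ∑ j : Fin 3, M i j • (![T q, Ytil q, Ztil q]) j) ∧
        Submodule.span ℝ
          ({T q, X q, lie4 T X q, lie4 X (lie4 T X) q} :
            Set ((Fin 3 → ℝ) × ℝ)) = ⊤) := by
  have hYd : Differentiable ℝ Y := hY.differentiable (by simp)
  have hZd : Differentiable ℝ Z := hZ.differentiable (by simp)
  have hcd : Differentiable ℝ c := hc.differentiable (by simp)
  have hfd : Differentiable ℝ fun q => fderiv ℝ c q (0, 1) :=
    ((hc.fderiv_right (m := (⊤ : ℕ∞)) (by simp)).clm_apply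
      contDiff_const).differentiable (by simp)
  have hderiv : deriv (fun τ => c (q.1, τ)) q.2 = fderiv ℝ c q (0, 1) := by
    have h := (hcd q).hasFDerivAt.comp_hasDerivAt q.2
      ((hasDerivAt_const q.2 q.1).prodMk (hasDerivAt_id q.2))
    exact h.deriv
  subst hYtil hZtil
  have hTX : lie4 T X = fun q =>
      (-(fderiv ℝ c q (0, 1) * sin (c q))) • (Y q.1, (0 : ℝ)) +
        (fderiv ℝ c q (0, 1) * cos (c q)) • (Z q.1, (0 : ℝ)) := by
    funext p
    subst hT hX
    rw [lie4, fderiv_lift_combination (hYd _) (hZd _) (hcd p).cos (hcd p).sin,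
      fderiv_cos (hcd p), fderiv_sin (hcd p)]
    ext1
    · simp [mul_comm]
    · simp
  obtain ⟨r, s, hXTX⟩ := lie4_lift_combination (Y := Y) (Z := Z) (q := q) (hYd _) (hZd _)
    (hcd q).cos (hcd q).sin ((hfd q).fun_mul (hcd q).sin).fun_neg ((hfd q).fun_mul (hcd q).cos)
  have hlast : cos (c q) * (fderiv ℝ c q (0, 1) * cos (c q)) -
      -(fderiv ℝ c q (0, 1) * sin (c q)) * sin (c q) = fderiv ℝ c q (0, 1) := by
    linear_combination fderiv ℝ c q (0, 1) * sin_sq_add_cos_sq (c q)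
  have hXTX' : lie4 X (lie4 T X) q =
      (r • Y q.1 + s • Z q.1 + fderiv ℝ c q (0, 1) • lie3 Y Z q.1, 0) := by
    rw [hTX, hX]
    refine hXTX.trans ?_
    rw [hlast]
  rw [hderiv, hXTX', hTX, hT, hX]
  beta_reduce
  generalize fderiv ℝ c q (0, 1) = f
  constructor
  · intro hf
    refine ⟨⟨!![1, 0, 0; 0, cos (c q), sin (c q); 0, -(f * sin (c q)), f * cos (c q)], ?_, ?_⟩,
      span_adapted_frame_eq_top (hcontact q.1) hf.ne' r s⟩
    · rw [Matrix.det_fin_three]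
      simp only [Matrix.of_apply, Matrix.cons_val]
      convert hf using 1
      linear_combination f * sin_sq_add_cos_sq (c q)
    · intro i
      fin_cases i <;> simp [Fin.sum_univ_three]
  · rintro ⟨⟨M, hM, hrow⟩, -⟩
    have hYZ : ∀ a b a' b' : ℝ, a • Y q.1 + b • Z q.1 = a' • Y q.1 + b' • Z q.1 →
        a = a' ∧ b = b' := by
      intro a b a' b' h
      have h0 := Fintype.linearIndependent_iff.1 (hcontact q.1) ![a - a', b - b', 0] (by
        simp only [Fin.sum_univ_three, Matrix.cons_val]
        rw [zero_smul, add_zero, sub_smul, sub_smul, sub_add_sub_comm, h, sub_self])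
      exact ⟨sub_eq_zero.1 (h0 0), sub_eq_zero.1 (h0 1)⟩
    have h0 := hrow 0
    have h1 := hrow 1
    have h2 := hrow 2
    simp only [Fin.sum_univ_three, Matrix.cons_val, Prod.ext_iff, Prod.fst_add, Prod.snd_add,
      Prod.smul_fst, Prod.smul_snd, smul_zero, zero_add, add_zero, smul_eq_mul, mul_one, mul_zero]
      at h0 h1 h2
    obtain ⟨e11, e12⟩ := hYZ _ _ _ _ h1.1
    obtain ⟨e21, e22⟩ := hYZ _ _ _ _ h2.1
    rw [Matrix.det_fin_three, ← h0.2, ← h1.2, ← h2.2, ← e11, ← e12, ← e21, ← e22] at hM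
    convert hM using 1
    linear_combination -f * sin_sq_add_cos_sq (c q)
end

section
/- Let D³ be the closed unit ball in ℝ³ and let c : D³ × [0,1] → ℝ be smooth, with ∂ₜc > 0 on some neighbourhood of the boundary ∂(D³ × [0,1]) and with c(p,1) > c(p,0) for every p ∈ D³. Then there exists a smooth map H : [0,1] × D³ × [0,1] → ℝ such that H(0,p,t) = c(p,t) for all (p,t), H(s,·,·) agrees with c on a fixed neighbourhood of ∂(D³ × [0,1]) for every s ∈ [0,1], and ∂ₜH(1,p,t) > 0 for all (p,t) ∈ D³ × [0,1]. (An angular shell whose angle function strictly increases from t = 0 to t = 1 is homotopic, relative to the boundary, to a solid Engel shell.) -/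
open Real Set

/-- The closed unit ball D³ ⊂ ℝ³. -/
def ball3 : Set (Fin 3 → ℝ) := {p | p 0 ^ 2 + p 1 ^ 2 + p 2 ^ 2 ≤ 1}

/-- The domain D³ × [0,1]. -/
def dom3 : Set ((Fin 3 → ℝ) × ℝ) := {q | q.1 ∈ ball3 ∧ q.2 ∈ Set.Icc 0 1}

/-- The boundary ∂(D³ × [0,1]). -/
def bdry3 : Set ((Fin 3 → ℝ) × ℝ) :=
  {q | q ∈ dom3 ∧ (q.1 0 ^ 2 + q.1 1 ^ 2 + q.1 2 ^ 2 = 1 ∨ q.2 = 0 ∨ q.2 = 1)}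

/-- Partial derivative in the t-direction of a function on ℝ³ × ℝ. -/
noncomputable def dt (c : ((Fin 3 → ℝ) × ℝ) → ℝ) (q : (Fin 3 → ℝ) × ℝ) : ℝ :=
  deriv (fun τ => c (q.1, τ)) q.2

theorem expNegInvGlue_hasDerivAt (x : ℝ) :
    HasDerivAt expNegInvGlue (x⁻¹ ^ 2 * expNegInvGlue x) x := by
  simpa using expNegInvGlue.hasDerivAt_polynomial_eval_inv_mul 1 x

theorem smoothTransition_exists_hasDerivAt (x : ℝ) :
    ∃ m, HasDerivAt smoothTransition m x ∧ 0 ≤ m ∧ (0 < x → x < 1 → 0 < m) := by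
  have hu := expNegInvGlue_hasDerivAt x
  have hv : HasDerivAt (fun y : ℝ => expNegInvGlue (1 - y))
      ((1 - x)⁻¹ ^ 2 * expNegInvGlue (1 - x) * (-1)) x :=
    (expNegInvGlue_hasDerivAt (1 - x)).comp x ((hasDerivAt_id x).const_sub 1)
  have hd := smoothTransition.pos_denom x
  have hu0 := expNegInvGlue.nonneg x
  have hv0 := expNegInvGlue.nonneg (1 - x)
  have heq : x⁻¹ ^ 2 * expNegInvGlue x * (expNegInvGlue x + expNegInvGlue (1 - x)) -
        expNegInvGlue x *
          (x⁻¹ ^ 2 * expNegInvGlue x + (1 - x)⁻¹ ^ 2 * expNegInvGlue (1 - x) * (-1)) =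
      (x⁻¹ ^ 2 + (1 - x)⁻¹ ^ 2) * (expNegInvGlue x * expNegInvGlue (1 - x)) := by ring
  refine ⟨_, hu.div (hu.add hv) hd.ne', ?_, fun h0 h1 => ?_⟩
  · refine div_nonneg (heq.symm ▸ ?_) (sq_nonneg _)
    positivity
  · have hup := expNegInvGlue.pos_of_pos h0
    have hvp := expNegInvGlue.pos_of_pos (sub_pos.2 h1)
    have hx : 0 < x⁻¹ := inv_pos.2 h0
    refine div_pos (heq.symm ▸ ?_) (pow_pos hd 2)
    positivity

/-- A smooth nondecreasing function equal to the identity on `(-∞, a / 2]` and to `a` on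
`[a, ∞)`. -/
theorem exists_smooth_ramp {a : ℝ} (ha : 0 < a) :
    ∃ α α' : ℝ → ℝ, ContDiff ℝ (⊤ : ℕ∞) α ∧ (∀ t, HasDerivAt α (α' t) t) ∧
      (∀ t, 0 ≤ α' t) ∧ (∀ t < a, 0 < α' t) ∧ (∀ t ≤ a / 2, α t = t) ∧
      (∀ t, a ≤ t → α t = a) ∧ (∀ t, 0 ≤ t → α t ∈ Icc 0 a) := by
  choose m hm hm0 _ using smoothTransition_exists_hasDerivAt
  have hone : ∀ t, a ≤ t → smoothTransition (t * (2 / a) - 1) = 1 := fun t ht => by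
    apply smoothTransition.one_of_one_le
    have h2 : a * (2 / a) = 2 := by field_simp
    have := mul_le_mul_of_nonneg_right ht (by positivity : 0 ≤ 2 / a)
    linarith
  have hlt : ∀ t < a, smoothTransition (t * (2 / a) - 1) < 1 := fun t ht => by
    apply smoothTransition.lt_one_of_lt_one
    have h2 : a * (2 / a) = 2 := by field_simp
    have := mul_lt_mul_of_pos_right ht (by positivity : 0 < 2 / a)
    linarith
  have hpos : ∀ t < a, 0 < 1 + (m (t * (2 / a) - 1) * (2 / a) * (a - t) +
      smoothTransition (t * (2 / a) - 1) * (-1)) := fun t ht => by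
    have h1 := hlt t ht
    have h2 : 0 ≤ m (t * (2 / a) - 1) * (2 / a) * (a - t) :=
      mul_nonneg (mul_nonneg (hm0 _) (by positivity)) (by linarith)
    linarith
  have hder : ∀ t, HasDerivAt (fun t => t + smoothTransition (t * (2 / a) - 1) * (a - t))
      (1 + (m (t * (2 / a) - 1) * (2 / a) * (a - t) +
        smoothTransition (t * (2 / a) - 1) * (-1))) t := fun t => by
    have h1 : HasDerivAt (fun t : ℝ => t * (2 / a) - 1) (2 / a) t := by
      simpa using ((hasDerivAt_id t).mul_const (2 / a)).sub_const 1
    exact (hasDerivAt_id t).add (((hm _).comp t h1).mul ((hasDerivAt_id t).const_sub a))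
  refine ⟨_, _, ?_, hder, fun t => ?_, hpos, fun t ht => ?_, fun t ht => ?_, fun t ht => ?_⟩
  · fun_prop
  · rcases lt_or_ge t a with h | h
    · exact (hpos t h).le
    · rcases h.eq_or_lt with rfl | h
      · simp [hone a le_rfl]
      · have hc : (fun t => t + smoothTransition (t * (2 / a) - 1) * (a - t)) =ᶠ[nhds t]
            fun _ => a := by
          filter_upwards [lt_mem_nhds h] with y hy
          rw [hone y hy.le]; ring
        exact ((hder t).unique ((hasDerivAt_const t a).congr_of_eventuallyEq hc)).ge
  · have h2 : a / 2 * (2 / a) = 1 := by field_simp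
    have := mul_le_mul_of_nonneg_right ht (by positivity : 0 ≤ 2 / a)
    rw [smoothTransition.zero_of_nonpos (by linarith)]; ring
  · rw [hone t ht]; ring
  · rcases lt_or_ge t a with h | h
    · have h0 := smoothTransition.nonneg (t * (2 / a) - 1)
      have h1 := (hlt t h).le
      constructor <;> nlinarith
    · rw [hone t h]
      constructor <;> linarith

/-- A smooth nondecreasing step from `0` to `1`, strictly increasing on `[a, 1 - a]`. -/
theorem exists_smooth_step {a : ℝ} (ha : 0 < a) (ha' : a < 1 / 2) :
    ∃ κ κ' : ℝ → ℝ, ContDiff ℝ (⊤ : ℕ∞) κ ∧ (∀ t, HasDerivAt κ (κ' t) t) ∧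
      (∀ t, 0 ≤ κ' t) ∧ (∀ t ∈ Icc a (1 - a), 0 < κ' t) ∧ (∀ t ≤ a / 2, κ t = 0) ∧
      (∀ t, 1 - a / 2 ≤ t → κ t = 1) := by
  choose m hm hm0 hmp using smoothTransition_exists_hasDerivAt
  have h1a : 0 < 1 - a := by linarith
  refine ⟨fun t => smoothTransition ((t - a / 2) / (1 - a)),
    fun t => m ((t - a / 2) / (1 - a)) * (1 / (1 - a)), ?_, fun t => ?_, fun t => ?_,
    fun t ht => ?_, fun t ht => ?_, fun t ht => ?_⟩
  · fun_prop
  · exact (hm _).comp t (((hasDerivAt_id t).sub_const (a / 2)).div_const (1 - a))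
  · exact mul_nonneg (hm0 _) (by positivity)
  · refine mul_pos (hmp _ (div_pos (by linarith [ht.1]) h1a) ?_) (by positivity)
    rw [div_lt_one h1a]
    linarith [ht.2]
  · exact smoothTransition.zero_of_nonpos (div_nonpos_of_nonpos_of_nonneg (by linarith) h1a.le)
  · apply smoothTransition.one_of_one_le
    rw [one_le_div h1a]
    linarith

theorem hasDerivAt_dt {c : ((Fin 3 → ℝ) × ℝ) → ℝ} (hc : ContDiff ℝ (⊤ : ℕ∞) c)
    (p : Fin 3 → ℝ) (t : ℝ) : HasDerivAt (fun τ => c (p, τ)) (dt c (p, t)) t := by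
  have h : ContDiff ℝ (⊤ : ℕ∞) (fun τ => c (p, τ)) := by fun_prop
  exact (h.differentiable (by simp) t).hasDerivAt

/-- Replacing `c` away from the two ends `t ≤ a / 2` and `t ≥ 1 - a / 2` by a function which is
increasing along every fibre whose ends are increasing and which satisfies
`c (p, a) < c (p, 1 - a)`. -/
theorem exists_increasing_rel_ends {c : ((Fin 3 → ℝ) × ℝ) → ℝ} (hc : ContDiff ℝ (⊤ : ℕ∞) c)
    {a : ℝ} (ha : 0 < a) (ha' : a < 1 / 2) :
    ∃ d : ((Fin 3 → ℝ) × ℝ) → ℝ, ContDiff ℝ (⊤ : ℕ∞) d ∧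
      (∀ q, q.2 ≤ a / 2 ∨ 1 - a / 2 ≤ q.2 → d q = c q) ∧
      ∀ p, (∀ t ∈ Icc 0 a, 0 < dt c (p, t) ∧ 0 < dt c (p, 1 - t)) → c (p, a) < c (p, 1 - a) →
        ∀ t ∈ Icc (0 : ℝ) 1, 0 < dt d (p, t) := by
  obtain ⟨α, α', hα, hdα, hα0, hαp, hαid, hαa, hαI⟩ := exists_smooth_ramp ha
  obtain ⟨κ, κ', hκ, hdκ, hκ0, hκp, hκz, hκo⟩ := exists_smooth_step ha ha'
  refine ⟨fun q => c (q.1, α q.2) + c (q.1, 1 - α (1 - q.2)) - c (q.1, 1 - a) +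
    κ q.2 * (c (q.1, 1 - a) - c (q.1, a)), by fun_prop, ?_, fun p hp hlt t ht => ?_⟩
  · rintro ⟨p, t⟩ (h | h) <;> simp only at h ⊢
    · rw [hαid t h, hαa (1 - t) (by linarith), hκz t h]; ring
    · rw [hαid (1 - t) (by linarith), hαa t (by linarith), hκo t h, sub_sub_cancel]; ring
  · have hβ : HasDerivAt (fun τ => 1 - α (1 - τ)) (α' (1 - t)) t := by
      simpa using ((hdα (1 - t)).comp t ((hasDerivAt_id t).const_sub 1)).const_sub 1
    have h1 : HasDerivAt (fun τ => c (p, α τ)) (dt c (p, α t) * α' t) t :=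
      (hasDerivAt_dt hc p (α t)).comp t (hdα t)
    have h2 : HasDerivAt (fun τ => c (p, 1 - α (1 - τ)))
        (dt c (p, 1 - α (1 - t)) * α' (1 - t)) t :=
      HasDerivAt.comp t (h₂ := fun τ => c (p, τ)) (hasDerivAt_dt hc p (1 - α (1 - t))) hβ
    have h := ((h1.add h2).sub_const (c (p, 1 - a))).add
      ((hdκ t).mul_const (c (p, 1 - a) - c (p, a)))
    have hd := h.deriv
    refine lt_of_lt_of_eq ?_ hd.symm
    have p1 := (hp _ (hαI t ht.1)).1
    have p2 := (hp _ (hαI (1 - t) (by linarith [ht.2]))).2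
    have p3 : 0 < c (p, 1 - a) - c (p, a) := by linarith
    have n1 := mul_nonneg p1.le (hα0 t)
    have n2 := mul_nonneg p2.le (hα0 (1 - t))
    have n3 := mul_nonneg (hκ0 t) p3.le
    rcases lt_or_ge t a with hta | hta
    · linarith [mul_pos p1 (hαp t hta)]
    · rcases lt_or_ge (1 - t) a with hta' | hta'
      · linarith [mul_pos p2 (hαp (1 - t) hta')]
      · linarith [mul_pos (hκp t ⟨hta, by linarith⟩) p3]

theorem isCompact_ball3 : IsCompact ball3 := by
  refine (isCompact_closedBall (0 : Fin 3 → ℝ) 1).of_isClosed_subset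
    (isClosed_le (by fun_prop) continuous_const) fun p hp => ?_
  have hp' : p 0 ^ 2 + p 1 ^ 2 + p 2 ^ 2 ≤ 1 := hp
  rw [mem_closedBall_zero_iff, pi_norm_le_iff_of_nonneg zero_le_one]
  intro i
  rw [Real.norm_eq_abs, ← sq_le_one_iff_abs_le_one]
  have h0 := sq_nonneg (p 0)
  have h1 := sq_nonneg (p 1)
  have h2 := sq_nonneg (p 2)
  fin_cases i <;> simp only [Fin.zero_eta, Fin.mk_one, Fin.reduceFinMk] <;> linarith

theorem exists_uniform_ends {c : ((Fin 3 → ℝ) × ℝ) → ℝ} (hc : Continuous c)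
    {V : Set ((Fin 3 → ℝ) × ℝ)} (hV : IsOpen V) (hbV : bdry3 ⊆ V)
    (hincr : ∀ p ∈ ball3, c (p, 0) < c (p, 1)) :
    ∃ a : ℝ, 0 < a ∧ a < 1 / 2 ∧ ∀ p ∈ ball3,
      (∀ t ∈ Icc 0 a, (p, t) ∈ V ∧ (p, 1 - t) ∈ V) ∧ c (p, a) < c (p, 1 - a) := by
  have hopen : IsOpen {q : (Fin 3 → ℝ) × ℝ |
      (q ∈ V ∧ (q.1, 1 - q.2) ∈ V) ∧ c q < c (q.1, 1 - q.2)} :=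
    (hV.inter (hV.preimage (by fun_prop : Continuous
      fun q : (Fin 3 → ℝ) × ℝ => (q.1, 1 - q.2)))).inter (isOpen_lt hc (by fun_prop))
  obtain ⟨U, W, -, hW, hU, h0, hUW⟩ := generalized_tube_lemma isCompact_ball3
    (isCompact_singleton (x := (0 : ℝ))) hopen (by
      rintro ⟨p, t⟩ ⟨hp, ht⟩
      simp only at hp
      obtain rfl : t = 0 := ht
      refine ⟨⟨hbV ⟨⟨hp, by simp⟩, by simp⟩, hbV ⟨⟨hp, by simp⟩, by simp⟩⟩, ?_⟩
      simpa using hincr p hp)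
  obtain ⟨ε, hε, hball⟩ := Metric.isOpen_iff.1 hW 0 (h0 rfl)
  have hmem : ∀ p ∈ ball3, ∀ t ∈ Icc 0 (min (ε / 2) (1 / 4)), (p, t) ∈ U ×ˢ W := fun p hp t ht =>
    ⟨hU hp, hball (by
      rw [Metric.mem_ball, dist_zero_right, Real.norm_eq_abs, abs_of_nonneg ht.1]
      linarith [ht.2, min_le_left (ε / 2) (1 / 4 : ℝ)])⟩
  have ha : 0 < min (ε / 2) (1 / 4) := by positivity
  refine ⟨_, ha, by linarith [min_le_right (ε / 2) (1 / 4 : ℝ)], fun p hp =>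
    ⟨fun t ht => (hUW (hmem p hp t ht)).1, (hUW (hmem p hp _ ⟨ha.le, le_rfl⟩)).2⟩⟩

theorem exists_collar {V : Set ((Fin 3 → ℝ) × ℝ)} (hV : IsOpen V) (hbV : bdry3 ⊆ V) :
    ∃ r < (1 : ℝ), ∀ p ∈ ball3, r < p 0 ^ 2 + p 1 ^ 2 + p 2 ^ 2 →
      ∀ t ∈ Icc (0 : ℝ) 1, (p, t) ∈ V := by
  have hcont : Continuous fun p : Fin 3 → ℝ => p 0 ^ 2 + p 1 ^ 2 + p 2 ^ 2 := by fun_prop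
  have hS : IsCompact (ball3 ∩ {p | p 0 ^ 2 + p 1 ^ 2 + p 2 ^ 2 = 1}) :=
    isCompact_ball3.inter_right (isClosed_eq hcont continuous_const)
  obtain ⟨U, W, hU, -, hSU, hIW, hUW⟩ := generalized_tube_lemma hS
    (isCompact_Icc (a := (0 : ℝ)) (b := 1)) hV
    (fun q hq => hbV ⟨⟨hq.1.1, hq.2⟩, Or.inl hq.1.2⟩)
  suffices h : ∃ r < (1 : ℝ), ∀ p ∈ ball3 \ U, p 0 ^ 2 + p 1 ^ 2 + p 2 ^ 2 ≤ r by
    obtain ⟨r, hr, h⟩ := h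
    refine ⟨r, hr, fun p hp hrp t ht => hUW ⟨?_, hIW ht⟩⟩
    by_contra hpU
    exact (h p ⟨hp, hpU⟩).not_gt hrp
  rcases (ball3 \ U).eq_empty_or_nonempty with he | hne
  · exact ⟨0, zero_lt_one, by simp [he]⟩
  · obtain ⟨x, hx, hmax⟩ := (isCompact_ball3.diff hU).exists_isMaxOn hne hcont.continuousOn
    exact ⟨_, lt_of_le_of_ne hx.1 fun h => hx.2 (hSU ⟨hx.1, h⟩), fun p hp => hmax hp⟩

/-- an angular shell whose angle function strictly increases from t = 0 to
t = 1 is homotopic, relative to the boundary, to a solid Engel shell. -/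
theorem increasing_angle_gives_solid_shell
    (c : ((Fin 3 → ℝ) × ℝ) → ℝ) (hc : ContDiff ℝ (⊤ : ℕ∞) c)
    (hbd : ∃ V : Set ((Fin 3 → ℝ) × ℝ), IsOpen V ∧ bdry3 ⊆ V ∧ ∀ q ∈ V, 0 < dt c q)
    (hincr : ∀ p ∈ ball3, c (p, 0) < c (p, 1)) :
    ∃ H : ℝ × ((Fin 3 → ℝ) × ℝ) → ℝ,
      ContDiff ℝ (⊤ : ℕ∞) H ∧
      (∀ q : (Fin 3 → ℝ) × ℝ, H (0, q) = c q) ∧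
      (∃ V : Set ((Fin 3 → ℝ) × ℝ), IsOpen V ∧ bdry3 ⊆ V ∧
        ∀ s ∈ Set.Icc (0:ℝ) 1, ∀ q ∈ V, H (s, q) = c q) ∧
      (∀ q ∈ dom3, 0 < dt (fun q' => H (1, q')) q) := by
  obtain ⟨V, hV, hbV, hpos⟩ := hbd
  obtain ⟨a, ha, ha', hends⟩ := exists_uniform_ends hc.continuous hV hbV hincr
  obtain ⟨r, hr, hcollar⟩ := exists_collar hV hbV
  obtain ⟨d, hd, hdc, hdpos⟩ := exists_increasing_rel_ends hc ha ha'
  let N : (Fin 3 → ℝ) → ℝ := fun p => p 0 ^ 2 + p 1 ^ 2 + p 2 ^ 2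
  let ρ : (Fin 3 → ℝ) → ℝ := fun p => smoothTransition ((N p - r) / ((1 - r) / 2))
  have hr2 : 0 < (1 - r) / 2 := by linarith
  have hN : ContDiff ℝ (⊤ : ℕ∞) N := by fun_prop
  have hρ : ContDiff ℝ (⊤ : ℕ∞) ρ :=
    smoothTransition.contDiff.comp ((hN.sub contDiff_const).div_const _)
  refine ⟨fun x => c x.2 + x.1 * ((1 - ρ x.2.1) * (d x.2 - c x.2)), by fun_prop, by simp,
    ⟨{q | q.2 < a / 2} ∪ {q | 1 - a / 2 < q.2} ∪ {q | (1 + r) / 2 < N q.1}, ?_, ?_, ?_⟩, ?_⟩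
  · exact ((isOpen_lt continuous_snd continuous_const).union
      (isOpen_lt continuous_const continuous_snd)).union
      (isOpen_lt continuous_const (hN.continuous.comp continuous_fst))
  · rintro ⟨p, t⟩ ⟨-, h | h | h⟩
    · refine Or.inr ?_
      change (1 + r) / 2 < N p
      have : N p = 1 := h
      linarith
    · refine Or.inl (Or.inl ?_)
      simp only at h
      simpa [h] using ha
    · refine Or.inl (Or.inr ?_)
      simp only at h
      simpa [h] using ha
  · rintro s - q ((h | h) | h)
    · simp [hdc q (Or.inl (le_of_lt h))]
    · simp [hdc q (Or.inr (le_of_lt h))]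
    · have hone : ρ q.1 = 1 := by
        apply smoothTransition.one_of_one_le
        rw [one_le_div hr2]
        have : (1 + r) / 2 < N q.1 := h
        linarith
      simp [hone]
  · rintro ⟨p, t⟩ ⟨hp, ht⟩
    simp only at hp ht
    have hder : HasDerivAt (fun τ => c (p, τ) + 1 * ((1 - ρ p) * (d (p, τ) - c (p, τ))))
        (dt c (p, t) + 1 * ((1 - ρ p) * (dt d (p, t) - dt c (p, t)))) t :=
      (hasDerivAt_dt hc p t).add
        ((((hasDerivAt_dt hd p t).sub (hasDerivAt_dt hc p t)).const_mul (1 - ρ p)).const_mul 1)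
    refine lt_of_lt_of_eq ?_ hder.deriv.symm
    have hdp : 0 < dt d (p, t) := hdpos p
      (fun τ hτ => ⟨hpos _ ((hends p hp).1 τ hτ).1, hpos _ ((hends p hp).1 τ hτ).2⟩)
      (hends p hp).2 t ht
    have hρ1 : ρ p ≤ 1 := smoothTransition.le_one _
    have hρ0 : 0 ≤ ρ p := smoothTransition.nonneg _
    rcases hρ0.eq_or_lt with h0 | h0
    · rw [← h0]; linarith
    · have hrp : r < N p := by
        by_contra hle
        exact h0.ne' (smoothTransition.zero_of_nonpos
          (div_nonpos_of_nonpos_of_nonneg (by linarith) hr2.le))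
      have hcp : 0 < dt c (p, t) := hpos _ (hcollar p hp hrp t ht)
      nlinarith [mul_pos h0 hcp, mul_nonneg (sub_nonneg.2 hρ1) hdp.le]
end
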